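/- Let G be a connected algebraic group over a field k and φ : G → G an isogeny with only finitely many fixed points. Then the Lang map L : G → G defined by L(g) = g·φ(g)⁻¹ is faithfully flat. -/

import Mathlib

universe u

section SmoothDomain

open TensorProduct

/-- In a ring integrally closed in a reduced Artinian overring, annihilators are generated by
idempotents. -/
theorem exists_idempotent_annihilator {S E : Type*} [CommRing S] [CommRing E] [Algebra S E]
    [IsArtinianRing E] [IsReduced E] (hinj : Function.Injective (algebraMap S E))
    (hint : ∀ x : E, IsIntegral S x → ∃ y : S, algebraMap S E y = x) (a : S) :
    ∃ e : S, a * e = 0 ∧ ∀ t : S, t * a = 0 → t * e = t := by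
  obtain ⟨n, c, hc⟩ := IsArtinian.exists_pow_succ_smul_dvd (algebraMap S E a) (1 : E)
  set b := algebraMap S E a
  simp only [smul_eq_mul, mul_one, Nat.succ_eq_add_one, pow_succ] at hc
  have hb : b * (1 - c * b) = 0 := by
    have h1 : (b * (1 - c * b)) ^ (n + 1) = 0 := by
      have : b ^ n * (1 - c * b) = 0 := by linear_combination -hc
      calc
        _ = (b ^ n * (1 - c * b)) * (b * (1 - c * b) ^ n) := by
          rw [mul_pow, pow_succ, pow_succ]
          ring
        _ = 0 := by rw [this, zero_mul]
    exact eq_zero_of_pow_eq_zero h1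
  have hid : IsIntegral S (1 - c * b) := by
    refine ⟨Polynomial.X ^ 2 - Polynomial.X, by monicity!, ?_⟩
    simp only [Polynomial.eval₂_sub, Polynomial.eval₂_pow, Polynomial.eval₂_X]
    linear_combination -c * hb
  obtain ⟨e, he⟩ := hint _ hid
  refine ⟨e, hinj ?_, fun t ht ↦ hinj ?_⟩
  · rw [map_mul, he, map_zero, hb]
  · have : algebraMap S E t * b = 0 := by rw [← map_mul, ht, map_zero]
    rw [map_mul, he]
    linear_combination -c * this

/-- Étale algebras over a polynomial ring over a field embed in reduced Artinian rings in which
they are integrally closed. -/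
theorem etale_local_properties {P S : Type*} [CommRing P] [IsDomain P] [IsIntegrallyClosed P]
    [CommRing S] [Algebra P S] [Algebra.Etale P S] :
    IsReduced S ∧ ∀ a : S, ∃ e : S, a * e = 0 ∧ ∀ t : S, t * a = 0 → t * e = t := by
  let K := FractionRing P
  have : Algebra.EssFiniteType K (K ⊗[P] S) := inferInstance
  have : Module.Finite K (K ⊗[P] S) := Algebra.FormallyUnramified.finite_of_free _ _
  have : IsReduced (K ⊗[P] S) := Algebra.FormallyUnramified.isReduced_of_field K (K ⊗[P] S)
  have : IsArtinianRing (K ⊗[P] S) := isArtinian_of_tower K inferInstance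
  let E := S ⊗[P] K
  let e : E ≃ₐ[P] K ⊗[P] S := Algebra.TensorProduct.comm P S K
  have : IsReduced E := isReduced_of_injective e e.injective
  have : IsArtinianRing E := e.symm.toRingEquiv.surjective.isArtinianRing
  have hinj : Function.Injective (algebraMap S E) :=
    Algebra.TensorProduct.includeLeft_injective (S := S)
      (IsFractionRing.injective P K)
  refine ⟨isReduced_of_injective (algebraMap S E) hinj, ?_⟩
  apply exists_idempotent_annihilator hinj
  intro x hx
  obtain ⟨y, hy⟩ := (TensorProduct.toIntegralClosure_bijective_of_smooth
    (R := P) (S := S) (B := K)).2 ⟨x, hx⟩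
  have hy' : Algebra.TensorProduct.map (AlgHom.id S S) (integralClosure P K).val y = x :=
    congrArg Subtype.val hy
  subst hy'
  clear hy hx
  induction y with
  | zero => exact ⟨0, by simp⟩
  | add x y hx hy =>
    obtain ⟨a, ha⟩ := hx
    obtain ⟨b, hb⟩ := hy
    exact ⟨a + b, by rw [map_add, ha, hb, map_add]⟩
  | tmul s z =>
    obtain ⟨p, hp⟩ := IsIntegrallyClosed.isIntegral_iff.1 z.2
    refine ⟨p • s, ?_⟩
    simp only [Algebra.TensorProduct.map_tmul, AlgHom.coe_id, id_eq, Subalgebra.coe_val, ← hp]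
    rw [Algebra.TensorProduct.algebraMap_apply, Algebra.algebraMap_self_apply,
      TensorProduct.smul_tmul, Algebra.smul_def, mul_one]

theorem isDomain_of_smooth_of_connectedSpace {k A : Type u} [Field k] [CommRing A] [Algebra k A]
    [Algebra.Smooth k A] (hconn : ConnectedSpace (PrimeSpectrum A)) : IsDomain A := by
  have : Nontrivial A := by
    obtain ⟨p⟩ := hconn.toNonempty
    exact ⟨0, 1, fun h ↦ p.isPrime.ne_top ((Ideal.eq_top_iff_one _).2 (h ▸ zero_mem _))⟩
  have hloc (p : PrimeSpectrum A) : ∃ f ∉ p.asIdeal, IsReduced (Localization.Away f) ∧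
      ∀ a : Localization.Away f, ∃ e, a * e = 0 ∧ ∀ t, t * a = 0 → t * e = t := by
    obtain ⟨f, hf, n, _, _, _⟩ :=
      Algebra.IsSmoothAt.exists_isStandardEtale_mvPolynomial (R := k) (p := p.asIdeal)
    exact ⟨f, hf, etale_local_properties (P := MvPolynomial (Fin n) k)⟩
  let Z (a : A) : Set (PrimeSpectrum A) := {p | ∃ t ∉ p.asIdeal, t * a = 0}
  have hzero (a : A) (h : Z a = Set.univ) : a = 0 := by
    by_contra ha
    have hne : Ideal.span {a} ≠ ⊥ := by simpa using ha
    have : (⊥ : Ideal A).colon {a} ≠ ⊤ := by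
      intro h
      have : (1 : A) ∈ (⊥ : Ideal A).colon {a} := h ▸ trivial
      rw [Submodule.mem_colon_singleton] at this
      simp at this
      exact ha this
    obtain ⟨m, hm, hle⟩ := Ideal.exists_le_maximal _ this
    obtain ⟨t, ht, h0⟩ : (⟨m, hm.isPrime⟩ : PrimeSpectrum A) ∈ Z a := h ▸ trivial
    exact ht (hle (by rw [Submodule.mem_colon_singleton]; simpa using h0))
  have hclopen (a : A) : IsClopen (Z a) := by
    refine ⟨?_, ?_⟩
    · rw [← isOpen_compl_iff, isOpen_iff_forall_mem_open]
      intro p hp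
      obtain ⟨f, hf, -, H⟩ := hloc p
      obtain ⟨e, he, het⟩ := H (algebraMap _ _ a)
      obtain ⟨⟨u, s, n, rfl⟩, hu⟩ := IsLocalization.surj (Submonoid.powers f) e
      simp only at hu
      have hup : u ∈ p.asIdeal := by
        by_contra hup
        have : algebraMap A (Localization.Away f) (u * a) = algebraMap _ _ 0 := by
          rw [map_mul, ← hu, map_zero]
          linear_combination algebraMap _ _ (f ^ n) * he
        obtain ⟨⟨_, m, rfl⟩, hm⟩ := (IsLocalization.eq_iff_exists (Submonoid.powers f) _).1 this
        refine hp ⟨f ^ m * u, fun h ↦ ?_, by simpa [mul_assoc] using hm⟩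
        rcases p.isPrime.mem_or_mem h with h | h
        · exact hf (p.isPrime.mem_of_pow_mem _ h)
        · exact hup h
      have hr : f ^ n - u ∉ p.asIdeal := fun h ↦
        hf (p.isPrime.mem_of_pow_mem n (by simpa using add_mem h hup))
      refine ⟨PrimeSpectrum.basicOpen (f * (f ^ n - u)), ?_, (PrimeSpectrum.basicOpen _).2, ?_⟩
      · rintro q hq ⟨t, ht, hta⟩
        have h1 := het (algebraMap _ _ t) (by rw [← map_mul, hta, map_zero])
        have : algebraMap A (Localization.Away f) (t * (f ^ n - u)) = algebraMap _ _ 0 := by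
          rw [map_mul, map_sub, ← hu, map_zero]
          linear_combination -algebraMap _ _ (f ^ n) * h1
        obtain ⟨⟨_, m, rfl⟩, hm⟩ := (IsLocalization.eq_iff_exists (Submonoid.powers f) _).1 this
        replace hm : f ^ m * (t * (f ^ n - u)) = 0 := by simpa using hm
        have hq' : f * (f ^ n - u) ∉ q.asIdeal := hq
        rcases q.isPrime.mem_or_mem (hm ▸ zero_mem _ : f ^ m * (t * (f ^ n - u)) ∈ q.asIdeal)
          with h | h
        · exact hq' (Ideal.mul_mem_right _ _ (q.isPrime.mem_of_pow_mem _ h))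
        · rcases q.isPrime.mem_or_mem h with h | h
          · exact ht h
          · exact hq' (Ideal.mul_mem_left _ _ h)
      · change f * (f ^ n - u) ∉ p.asIdeal
        intro h
        rcases p.isPrime.mem_or_mem h with h | h
        exacts [hf h, hr h]
    · rw [isOpen_iff_forall_mem_open]
      rintro p ⟨t, ht, hta⟩
      exact ⟨PrimeSpectrum.basicOpen t, fun q hq ↦ ⟨t, hq, hta⟩, (PrimeSpectrum.basicOpen _).2, ht⟩
  have hred : IsReduced A := by
    refine ⟨fun x hx ↦ hzero x (Set.eq_univ_of_forall fun p ↦ ?_)⟩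
    obtain ⟨f, hf, hr, -⟩ := hloc p
    have : algebraMap A (Localization.Away f) x = algebraMap _ _ 0 := by
      rw [map_zero]
      exact (hx.map (algebraMap A (Localization.Away f))).eq_zero
    obtain ⟨⟨_, m, rfl⟩, hm⟩ := (IsLocalization.eq_iff_exists (Submonoid.powers f) _).1 this
    exact ⟨f ^ m, fun h ↦ hf (p.isPrime.mem_of_pow_mem _ h), by simpa using hm⟩
  have : NoZeroDivisors A := by
    refine ⟨fun {a b} hab ↦ ?_⟩
    rcases isClopen_iff.1 (hclopen a) with h | h
    · right
      have hb : IsNilpotent b := by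
        rw [← mem_nilradical, nilradical_eq_sInf]
        refine (Ideal.mem_sInf).2 fun {p} (hp : p.IsPrime) ↦ ?_
        by_contra hbp
        have : (⟨p, hp⟩ : PrimeSpectrum A) ∈ Z a := ⟨b, hbp, by rw [mul_comm, hab]⟩
        rw [h] at this
        exact this
      exact hb.eq_zero
    · exact Or.inl (hzero a h)
  exact NoZeroDivisors.to_isDomain A

end SmoothDomain

section Points

open TensorProduct Coalgebra Bialgebra WithConv

/-- The `C`-valued points of the affine group scheme `Spec A` over `R`. -/
abbrev Points (R A C : Type*) [CommRing R] [CommRing A] [HopfAlgebra R A] [CommRing C]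
    [Algebra R C] := WithConv (A →ₐ[R] C)

namespace Points

variable {R A C D : Type*} [CommRing R] [CommRing A] [HopfAlgebra R A] [CommRing C]
    [Algebra R C] [CommRing D] [Algebra R D]

noncomputable instance : Group (Points R A C) where
  inv f := toConv <| f.ofConv.comp (HopfAlgebra.antipodeAlgHom R A)
  inv_mul_cancel f := by
    have h := AlgHom.comp_convMul_distrib f.ofConv
      (toConv (HopfAlgebra.antipodeAlgHom R A)) (toConv (AlgHom.id R A))
    rw [AlgHom.antipode_id_cancel] at h
    refine (congrArg toConv h).symm.trans ?_
    refine WithConv.ofConv_injective (AlgHom.ext fun x ↦ ?_)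
    exact f.ofConv.commutes _

/-- Functoriality of points in the coefficient ring. -/
noncomputable def push (φ : C →ₐ[R] D) : Points R A C →* Points R A D :=
  MonoidHom.mk' (fun x ↦ toConv (φ.comp x.ofConv)) fun x y ↦ by
    exact congrArg toConv (AlgHom.comp_convMul_distrib φ x y)

@[simp] theorem push_ofConv (φ : C →ₐ[R] D) (x : Points R A C) :
    (push φ x).ofConv = φ.comp x.ofConv := rfl

theorem mul_ofConv_apply (x y : Points R A C) (a : A) :
    (x * y).ofConv a = Algebra.TensorProduct.lift x.ofConv y.ofConv (fun _ _ ↦ .all ..)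
      (comul (R := R) a) := AlgHom.convMul_apply x y a

/-- The action on points of a group endomorphism. -/
noncomputable def pull (ψ : A →ₐ[R] A)
    (hψ : comul ∘ₗ ψ.toLinearMap =
      TensorProduct.map ψ.toLinearMap ψ.toLinearMap ∘ₗ comul (R := R) (A := A)) :
    Points R A C →* Points R A C :=
  MonoidHom.mk' (fun x ↦ toConv (x.ofConv.comp ψ)) fun x y ↦ by
    refine WithConv.ofConv_injective (AlgHom.ext fun a ↦ ?_)
    have h : comul (R := R) (ψ a) = TensorProduct.map ψ.toLinearMap ψ.toLinearMap
      (comul (R := R) a) := LinearMap.congr_fun hψ a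
    rw [mul_ofConv_apply]
    change (x * y).ofConv (ψ a) = _
    rw [mul_ofConv_apply, h]
    generalize comul (R := R) a = t
    induction t with
    | zero => simp
    | add x y hx hy => simp only [map_add, hx, hy]
    | tmul x y => simp

variable (ψ : A →ₐ[R] A)
    (hψ : comul ∘ₗ ψ.toLinearMap =
      TensorProduct.map ψ.toLinearMap ψ.toLinearMap ∘ₗ comul (R := R) (A := A))

theorem push_pull (φ : C →ₐ[R] D) (x : Points R A C) :
    push φ (pull ψ hψ x) = pull ψ hψ (push φ x) := rfl

/-- The comorphism of the Lang map `g ↦ g φ(g)⁻¹`. -/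
noncomputable def langHom : A →ₐ[R] A :=
  ((toConv (AlgHom.id R A) : Points R A A) * (toConv ψ)⁻¹).ofConv

include hψ in
theorem comp_langHom (x : Points R A C) :
    toConv (x.ofConv.comp (langHom ψ)) = x * (pull ψ hψ x)⁻¹ := by
  change push x.ofConv ((toConv (AlgHom.id R A) : Points R A A) * (toConv ψ)⁻¹) = _
  rw [map_mul, map_inv]
  rfl

theorem langHom_apply (a : A) : langHom ψ a = LinearMap.mul' R A
      ((TensorProduct.map LinearMap.id
        (ψ.toLinearMap ∘ₗ (HopfAlgebra.antipode (R := R) (A := A))))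
        (comul (R := R) a)) := by
  rw [langHom, mul_ofConv_apply]
  generalize comul (R := R) a = t
  induction t with
  | zero => simp
  | add x y hx hy => simp only [map_add, hx, hy]
  | tmul x y => simp; rfl

end Points

end Points

section LangFlat

open TensorProduct Coalgebra Bialgebra WithConv

/-- A ring endomorphism of a Noetherian domain which fixes a prime `m` and whose fibre over `m` is
Artinian is injective. -/
theorem injective_of_isArtinianRing_fibre {A : Type*} [CommRing A] [IsDomain A]
    [IsNoetherianRing A] (L : A →+* A) (m : Ideal A) [m.IsPrime] (hm : m.comap L = m)
    [IsArtinianRing (A ⧸ m.map L)] : Function.Injective L := by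
  rw [RingHom.injective_iff_ker_eq_bot]
  by_contra hne
  set P := RingHom.ker L
  have hPm : P ≤ m := by
    rw [← hm]
    exact fun x hx ↦ by simp [Ideal.mem_comap, RingHom.mem_ker.1 hx]
  let R := A ⧸ P
  algebraize [RingHom.kerLift L]
  let p : Ideal R := m.map (Ideal.Quotient.mk P)
  have hcomap : p.comap (Ideal.Quotient.mk P) = m := by
    rw [Ideal.comap_map_of_surjective _ Ideal.Quotient.mk_surjective]
    rw [← RingHom.ker_eq_comap_bot, Ideal.mk_ker, sup_eq_left]
    exact hPm
  have hp : p.IsPrime := Ideal.map_isPrime_of_surjective Ideal.Quotient.mk_surjective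
    (by rwa [Ideal.mk_ker])
  have hmap : p.map (algebraMap R A) = m.map L := by
    rw [Ideal.map_map]
    rfl
  have hover : m.LiesOver p := by
    refine ⟨Ideal.comap_injective_of_surjective _ Ideal.Quotient.mk_surjective ?_⟩
    rw [hcomap, Ideal.under_def, Ideal.comap_comap]
    exact hm.symm
  have key := Ideal.height_le_height_add_of_liesOver p m
  have hArt : IsArtinianRing (A ⧸ p.map (algebraMap R A)) := by rw [hmap]; infer_instance
  have hle : p.map (algebraMap R A) ≤ m := by rw [hmap, Ideal.map_le_iff_le_comap, hm]
  have hprime : (m.map (Ideal.Quotient.mk (p.map (algebraMap R A)))).IsPrime :=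
    Ideal.map_isPrime_of_surjective Ideal.Quotient.mk_surjective (by rwa [Ideal.mk_ker])
  have h0 : (m.map (Ideal.Quotient.mk (p.map (algebraMap R A)))).height = 0 := by
    rw [Ideal.height_eq_zero_iff]
    exact Ideal.mem_minimalPrimes_of_krullDimLE_zero _
  rw [h0, add_zero] at key
  obtain ⟨l, hl, hlen⟩ := p.exists_ltSeries_length_eq_height
  let l' : LTSeries (PrimeSpectrum A) := l.map (PrimeSpectrum.comap (Ideal.Quotient.mk P))
    (RingHom.strictMono_comap_of_surjective Ideal.Quotient.mk_surjective)
  let b : PrimeSpectrum A := ⟨⊥, Ideal.isPrime_bot⟩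
  have hlt : b < l'.head := by
    rw [← PrimeSpectrum.asIdeal_lt_asIdeal]
    refine lt_of_lt_of_le (bot_lt_iff_ne_bot.2 hne) ?_
    intro x hx
    rw [LTSeries.head_map]
    rw [PrimeSpectrum.comap_asIdeal, Ideal.mem_comap]
    rw [Ideal.Quotient.eq_zero_iff_mem.2 hx]
    exact zero_mem _
  have hlast : (l'.cons b hlt).last ≤ ⟨m, inferInstance⟩ := by
    rw [RelSeries.last_cons, LTSeries.last_map, hl, ← PrimeSpectrum.asIdeal_le_asIdeal]
    exact hcomap.le
  have h1 := Order.length_le_height hlast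
  rw [← PrimeSpectrum.height_eq_orderHeight] at h1
  have h2 : (l'.cons b hlt).length = l.length + 1 := by
    rw [RelSeries.cons_length]; rfl
  rw [h2, Nat.cast_add, hlen] at h1
  have h3 := h1.trans key
  have hfin : p.height ≠ ⊤ := Ideal.height_ne_top_of_isPrime
  obtain ⟨n, hn⟩ := ENat.ne_top_iff_exists.1 hfin
  rw [← hn] at h3
  norm_cast at h3
  omega

theorem Module.Flat.of_faithfullyFlat_tower (R S T : Type*) [CommRing R] [CommRing S] [CommRing T]
    [Algebra R S] [Algebra S T] [Algebra R T] [IsScalarTower R S T] [Module.FaithfullyFlat S T]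
    [Module.Flat R T] : Module.Flat R S := by
  rw [Module.Flat.iff_lTensor_preserves_injective_linearMap]
  intro N N' _ _ _ _ f hf
  let g : S ⊗[R] N →ₗ[S] S ⊗[R] N' := AlgebraTensorModule.lTensor S S f
  change Function.Injective g
  rw [← Module.FaithfullyFlat.lTensor_injective_iff_injective S T]
  let e := AlgebraTensorModule.cancelBaseChange R S S T N
  let e' := AlgebraTensorModule.cancelBaseChange R S S T N'
  have h : e'.toLinearMap ∘ₗ g.lTensor T ∘ₗ e.symm.toLinearMap =
      AlgebraTensorModule.lTensor S T f := by
    ext t n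
    simp [e, e', g]
  have h2 : Function.Injective (AlgebraTensorModule.lTensor S T f) :=
    Module.Flat.lTensor_preserves_injective_linearMap f hf
  rw [← h] at h2
  have h3 : Function.Injective (g.lTensor T ∘ₗ e.symm.toLinearMap) :=
    Function.Injective.of_comp (f := e') h2
  have : ⇑(g.lTensor T) = (g.lTensor T ∘ₗ e.symm.toLinearMap) ∘ e := by
    ext x; simp
  rw [this]
  exact h3.comp e.injective

theorem RingHom.Flat.of_comp_faithfullyFlat {R S T : Type*} [CommRing R] [CommRing S] [CommRing T]
    {f : R →+* S} {g : S →+* T} (hg : g.FaithfullyFlat) (hgf : (g.comp f).Flat) : f.Flat := by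
  algebraize [f, g, g.comp f]
  exact Module.Flat.of_faithfullyFlat_tower R S T

theorem RingHom.FaithfullyFlat.of_flat_of_forall_isMaximal {S T : Type*} [CommRing S] [CommRing T]
    {g : S →+* T} (hg : g.Flat) (h : ∀ m : Ideal S, m.IsMaximal → m.map g ≠ ⊤) :
    g.FaithfullyFlat := by
  algebraize [g]
  refine (Module.faithfullyFlat_iff _ _).2 ⟨hg, fun {m} hm htop ↦ h m hm ?_⟩
  rw [Ideal.smul_top_eq_map] at htop
  exact (Submodule.restrictScalars_eq_top_iff S _ _).1 htop

theorem flat_localization_algebraMapSubmonoid (R S : Type*) [CommRing R] [IsDomain R] [CommRing S]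
    [Algebra R S] :
    Module.Flat R (Localization (Algebra.algebraMapSubmonoid S (nonZeroDivisors R))) := by
  let K := Localization (nonZeroDivisors R)
  let S' := Localization (Algebra.algebraMapSubmonoid S (nonZeroDivisors R))
  have : Module.Flat R K := IsLocalization.flat _ (nonZeroDivisors R)
  let : Field K := inferInstanceAs (Field (FractionRing R))
  have : Module.Flat K S' := inferInstance
  exact Module.Flat.trans R K S'

theorem flat_localization_map {R S : Type*} [CommRing R] [IsDomain R] [CommRing S] (L : R →+* S) :
    ((algebraMap S (Localization ((nonZeroDivisors R).map L))).comp L).Flat := by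
  let := L.toAlgebra
  exact RingHom.flat_algebraMap_iff.2 (flat_localization_algebraMapSubmonoid R S)

namespace Points

variable {k A : Type*} [Field k] [CommRing A] [HopfAlgebra k A]

/-- The second coordinate as a point of `A` with values in `A ⊗ C`. -/
noncomputable abbrev snd (C : Type*) [CommRing C] [Algebra k C] (x : Points k A C) :
    Points k A (A ⊗[k] C) := push Algebra.TensorProduct.includeRight x

/-- The comorphism of `(g, h) ↦ (g, u(g) h w(g))`. -/
noncomputable def shear (u w : Points k A A) : A ⊗[k] A →ₐ[k] A ⊗[k] A :=
  Algebra.TensorProduct.lift Algebra.TensorProduct.includeLeft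
    (push Algebra.TensorProduct.includeLeft u * snd A (toConv (AlgHom.id k A)) *
      push Algebra.TensorProduct.includeLeft w).ofConv fun _ _ ↦ .all ..

theorem push_shear_includeLeft (u w v : Points k A A) :
    push (shear u w) (push Algebra.TensorProduct.includeLeft v) =
      push Algebra.TensorProduct.includeLeft v := by
  refine WithConv.ofConv_injective (AlgHom.ext fun a ↦ ?_)
  simp [shear]

theorem push_shear_snd (u w : Points k A A) :
    push (shear u w) (snd A (toConv (AlgHom.id k A))) =
      (push Algebra.TensorProduct.includeLeft u * snd A (toConv (AlgHom.id k A)) *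
      push Algebra.TensorProduct.includeLeft w) := by
  refine WithConv.ofConv_injective (AlgHom.ext fun a ↦ ?_)
  simp [shear]

theorem shear_comp_shear (u w u' w' : Points k A A) :
    (shear u w).comp (shear u' w') = shear (u' * u) (w * w') := by
  apply Algebra.TensorProduct.ext
  · ext a
    simp [shear]
  · have h : push (shear u w) (push (shear u' w') (snd A (toConv (AlgHom.id k A)))) =
        push (shear (u' * u) (w * w')) (snd A (toConv (AlgHom.id k A))) := by
      simp only [push_shear_snd, map_mul, push_shear_includeLeft, mul_assoc]
    exact congrArg WithConv.ofConv h

theorem shear_one : shear (1 : Points k A A) 1 = AlgHom.id k _ := by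
  apply Algebra.TensorProduct.ext
  · ext a
    simp [shear]
  · simp only [shear, map_one, one_mul, mul_one]
    ext a
    simp

theorem shear_bijective (u w : Points k A A) : Function.Bijective (shear u w) := by
  have h1 : (shear u w).comp (shear u⁻¹ w⁻¹) = AlgHom.id k _ := by
    rw [shear_comp_shear, inv_mul_cancel, mul_inv_cancel, shear_one]
  have h2 : (shear u⁻¹ w⁻¹).comp (shear u w) = AlgHom.id k _ := by
    rw [shear_comp_shear, inv_mul_cancel, mul_inv_cancel, shear_one]
  exact ⟨Function.LeftInverse.injective fun x ↦ AlgHom.congr_fun h2 x,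
    Function.RightInverse.surjective fun x ↦ AlgHom.congr_fun h1 x⟩

/-- The map `(g, h) ↦ u(g) h w(g)` is flat, also after composing with a flat map in `h`. -/
theorem flat_mul_mul {C : Type*} [CommRing C] [Algebra k C] (x : Points k A C)
    (hx : x.ofConv.toRingHom.Flat) (u w : Points k A A) :
    ((push Algebra.TensorProduct.includeLeft u * snd C x *
      push Algebra.TensorProduct.includeLeft w : Points k A (A ⊗[k] C)).ofConv.toRingHom).Flat := by
  have h : push (Algebra.TensorProduct.map (AlgHom.id k A) x.ofConv)
      (push (shear u w) (snd A (toConv (AlgHom.id k A)))) =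
      push Algebra.TensorProduct.includeLeft u * snd C x *
      push Algebra.TensorProduct.includeLeft w := by
    rw [push_shear_snd, map_mul, map_mul]
    congr 1
    · congr 1
      · refine WithConv.ofConv_injective (AlgHom.ext fun a ↦ ?_)
        simp
    · refine WithConv.ofConv_injective (AlgHom.ext fun a ↦ ?_)
      simp
  rw [← h]
  have h1 : (Algebra.TensorProduct.map (AlgHom.id k A) x.ofConv).toRingHom.Flat :=
    RingHom.Flat.lTensor (S := k) (R := k) A hx
  have h2 : (shear u w).toRingHom.Flat := RingHom.Flat.of_bijective (shear_bijective u w)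
  have h3 : (Algebra.TensorProduct.includeRight : A →ₐ[k] A ⊗[k] A).toRingHom.Flat := by
    have h := (RingHom.flat_algebraMap_iff (R := A) (S := A ⊗[k] A)).2 inferInstance
    exact h.comp (RingHom.Flat.of_bijective
      (f := (Algebra.TensorProduct.comm k A A : A ⊗[k] A →+* A ⊗[k] A))
      (Algebra.TensorProduct.comm k A A).bijective)
  exact (h3.comp h2).comp h1

theorem langHom_flat [IsDomain A] (ψ : A →ₐ[k] A)
    (hψ : comul ∘ₗ ψ.toLinearMap =
      TensorProduct.map ψ.toLinearMap ψ.toLinearMap ∘ₗ comul (R := k) (A := A))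
    (hinj : Function.Injective (langHom ψ)) : (langHom ψ).toRingHom.Flat := by
  obtain ⟨C, _, _, x, hx, hC⟩ : ∃ (C : Type _) (_ : CommRing C) (_ : Algebra k C)
      (x : Points k A C), (push x.ofConv (toConv (langHom ψ))).ofConv.toRingHom.Flat ∧
      x.ofConv.toRingHom.Flat ∧ Nontrivial C := by
    let M := (nonZeroDivisors A).map (langHom ψ)
    refine ⟨Localization M, inferInstance, inferInstance,
      toConv (IsScalarTower.toAlgHom k A (Localization M)), ?_, ?_, ?_⟩
    · exact flat_localization_map (langHom ψ).toRingHom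
    · exact RingHom.flat_algebraMap_iff.2 (IsLocalization.flat _ M)
    · refine OreLocalization.nontrivial_of_nonZeroDivisors ?_
      rintro _ ⟨a, ha, rfl⟩
      refine mem_nonZeroDivisors_of_ne_zero fun h ↦ ?_
      exact nonZeroDivisors.ne_zero ha (hinj (h.trans (map_zero _).symm))
  obtain ⟨hCf, hCn⟩ := hC
  let i : Points k A (A ⊗[k] C) := push Algebra.TensorProduct.includeLeft (toConv (AlgHom.id k A))
  let j : Points k A (A ⊗[k] C) := i⁻¹ * snd C x
  have hjflat : j.ofConv.toRingHom.Flat := by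
    have := flat_mul_mul x hCf (toConv (AlgHom.id k A))⁻¹ 1
    rwa [map_one, mul_one, map_inv] at this
  have hjL : toConv (j.ofConv.comp (langHom ψ)) =
      i⁻¹ * snd C (push x.ofConv (toConv (langHom ψ))) * pull ψ hψ i := by
    have h1 : push x.ofConv (toConv (langHom ψ)) = x * (pull ψ hψ x)⁻¹ := comp_langHom ψ hψ x
    rw [comp_langHom ψ hψ, h1]
    simp only [j, snd, map_mul, map_inv, push_pull, mul_inv_rev, inv_inv, mul_assoc]
  have hjLflat : (j.ofConv.comp (langHom ψ)).toRingHom.Flat := by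
    have := flat_mul_mul _ hx (toConv (AlgHom.id k A))⁻¹ (pull ψ hψ (toConv (AlgHom.id k A)))
    rw [map_inv, push_pull, ← hjL] at this
    exact this
  have hff : j.ofConv.toRingHom.FaithfullyFlat := by
    refine .of_flat_of_forall_isMaximal hjflat fun m hm htop ↦ ?_
    let : Field (A ⧸ m) := Ideal.Quotient.field m
    let D := (A ⧸ m) ⊗[k] C
    let g : Points k A D := push Algebra.TensorProduct.includeLeft (toConv (Ideal.Quotient.mkₐ k m))
    let y : Points k A D := push Algebra.TensorProduct.includeRight x
    let q : A ⊗[k] C →ₐ[k] D := Algebra.TensorProduct.lift (y * g⁻¹).ofConv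
      Algebra.TensorProduct.includeRight fun _ _ ↦ .all ..
    have hqi : push q i = y * g⁻¹ := by
      refine WithConv.ofConv_injective (AlgHom.ext fun a ↦ ?_)
      simp [q, i]
    have hqx : push q (snd C x) = y := by
      refine WithConv.ofConv_injective (AlgHom.ext fun a ↦ ?_)
      simp [q, y]
    have hq : push q j = g := by
      simp only [j, map_mul, map_inv, hqi, hqx]
      group
    have : (m.map j.ofConv.toRingHom).map q.toRingHom ≤ ⊥ := by
      rw [Ideal.map_map, Ideal.map_le_iff_le_comap]
      intro a ha
      have h1 : q (j.ofConv a) = g.ofConv a := congrArg (fun z : Points k A D ↦ z.ofConv a) hq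
      have h2 : g.ofConv a = 0 := by
        have : Ideal.Quotient.mk m a = 0 := Ideal.Quotient.eq_zero_iff_mem.2 ha
        simp [g, this]
      exact h1.trans h2
    rw [htop, Ideal.map_top, top_le_iff] at this
    have hD : Nontrivial D := inferInstance
    exact bot_ne_top this
  exact RingHom.Flat.of_comp_faithfullyFlat hff hjLflat

theorem counit_comp_langHom (ψ : A →ₐ[k] A)
    (hψ : comul ∘ₗ ψ.toLinearMap =
      TensorProduct.map ψ.toLinearMap ψ.toLinearMap ∘ₗ comul (R := k) (A := A)) (a : A) :
    counit (R := k) (langHom ψ a) = counit (R := k) a := by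
  have h := comp_langHom ψ hψ (1 : Points k A k)
  rw [map_one, inv_one, mul_one] at h
  exact congrArg (fun z : Points k A k ↦ z.ofConv a) h

theorem langHom_injective [IsDomain A] [Algebra.FiniteType k A] (ψ : A →ₐ[k] A)
    (hψ : comul ∘ₗ ψ.toLinearMap =
      TensorProduct.map ψ.toLinearMap ψ.toLinearMap ∘ₗ comul (R := k) (A := A))
    (hfix : Module.Finite k (A ⧸ (Ideal.span {x : A | ∃ a : A, x = ψ a - a} : Ideal A))) :
    Function.Injective (langHom ψ) := by
  have : IsNoetherianRing A := Algebra.FiniteType.isNoetherianRing k A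
  let m : Ideal A := RingHom.ker (counitAlgHom k A)
  have hm : m.comap (langHom ψ).toRingHom = m := by
    ext a
    exact (congrArg (· = 0) (counit_comp_langHom ψ hψ a)).to_iff
  let I := m.map (langHom ψ).toRingHom
  let π : Points k A (A ⧸ I) := toConv (Ideal.Quotient.mkₐ k I)
  have h1 : toConv (π.ofConv.comp (langHom ψ)) = 1 := by
    refine WithConv.ofConv_injective (AlgHom.ext fun a ↦ ?_)
    have : langHom ψ a - algebraMap k A (counit a) ∈ I := by
      have h : a - algebraMap k A (counit a) ∈ m := by
        simp [m, RingHom.mem_ker]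
      have := Ideal.mem_map_of_mem (langHom ψ).toRingHom h
      rw [map_sub] at this
      exact (AlgHom.commutes (langHom ψ) (counit a)) ▸ this
    exact (Ideal.Quotient.eq.2 this)
  have h2 : pull ψ hψ π = π := by
    rw [comp_langHom ψ hψ, mul_inv_eq_one] at h1
    exact h1.symm
  have hle : Ideal.span {x : A | ∃ a : A, x = ψ a - a} ≤ I := by
    rw [Ideal.span_le]
    rintro _ ⟨a, rfl⟩
    exact Ideal.Quotient.eq.1 (congrArg (fun z : Points k A (A ⧸ I) ↦ z.ofConv a) h2)
  have hfin : Module.Finite k (A ⧸ I) :=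
    Module.Finite.of_surjective (Ideal.Quotient.factorₐ k hle).toLinearMap
      (Ideal.Quotient.factor_surjective hle)
  have : IsArtinianRing (A ⧸ I) := isArtinian_of_tower k inferInstance
  have : m.IsPrime := RingHom.ker_isPrime _
  exact injective_of_isArtinianRing_fibre (langHom ψ).toRingHom m hm

end Points

end LangFlat

/-- Surjectivity of the Lang map of `φ` on a subgroup `Y`, deduced by counting from the surjectivity
of the Lang maps of all powers of a Frobenius `F` commuting with `φ`. -/
theorem lang_surjOn_of_frobenius {X : Type*} [Group X] (F φ : X →* X)
    (hcomm : ∀ x, F (φ x) = φ (F x)) (hper : ∀ x, ∃ m, 0 < m ∧ F^[m] x = x)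
    (hfixF : ∀ m, 0 < m → {x | F^[m] x = x}.Finite) (hfixφ : {x | φ x = x}.Finite)
    (Y : Subgroup X) [Y.Normal] [Y.FiniteIndex] (hφY : ∀ y ∈ Y, φ y ∈ Y)
    (hLang : ∀ m, 0 < m → ∀ y ∈ Y, ∃ g, g * (F^[m] g)⁻¹ = y) :
    ∀ y ∈ Y, ∃ g ∈ Y, g * (φ g)⁻¹ = y := by
  classical
  intro y hy
  have hperS (S : Set X) (hS : S.Finite) : ∃ m, 0 < m ∧ ∀ x ∈ S, F^[m] x = x := by
    induction S, hS using Set.Finite.induction_on with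
    | empty => exact ⟨1, one_pos, by simp⟩
    | @insert a S _ _ ih =>
      obtain ⟨m, hm, h⟩ := ih
      obtain ⟨n, hn, h'⟩ := hper a
      refine ⟨m * n, Nat.mul_pos hm hn, ?_⟩
      rintro x (rfl | hx)
      · exact Function.IsPeriodicPt.const_mul h' m
      · exact Function.IsPeriodicPt.mul_const (h x hx) n
  obtain ⟨m, hm, hfS⟩ := hperS (({y} ∪ {x | φ x = x}) ∪
    Set.range (fun q : X ⧸ Y ↦ q.out)) (((Set.finite_singleton y).union hfixφ).union
      (Set.finite_range _))
  let f : X →* X := ((show Monoid.End X from F) ^ m : Monoid.End X)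
  have hf (x : X) : f x = F^[m] x := congrFun (Monoid.End.coe_pow _ (show Monoid.End X from F) m) x
  have hfφ (x : X) : f (φ x) = φ (f x) := by
    rw [hf, hf]
    exact (Function.Commute.iterate_left (f := F) (g := φ) hcomm m) x
  have hLf (z : X) (hz : z ∈ Y) : ∃ g ∈ Y, g * (f g)⁻¹ = z := by
    obtain ⟨g, hg⟩ := hLang m hm z hz
    have hr : f (QuotientGroup.mk (s := Y) g).out = (QuotientGroup.mk (s := Y) g).out := by
      rw [hf]; exact hfS _ (Or.inr ⟨_, rfl⟩)
    set r := (QuotientGroup.mk (s := Y) g).out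
    have hrg : r⁻¹ * g ∈ Y := QuotientGroup.eq.1 (QuotientGroup.out_eq' _)
    refine ⟨g * r⁻¹, ‹Y.Normal›.mem_comm hrg, ?_⟩
    rw [map_mul, map_inv, hr, ← hg, hf]
    group
  let Γ : Set X := {x | x ∈ Y ∧ f x = x}
  let E : Set X := {x | x ∈ Y ∧ φ x = x}
  have hΓ : Γ.Finite := (hfixF m hm).subset fun x hx ↦ (hf x).symm.trans hx.2
  have hE : E.Finite := hfixφ.subset fun x hx ↦ hx.2
  have : Fintype Γ := hΓ.fintype
  have : Fintype E := hE.fintype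
  have hh (e : E) : ∃ h ∈ Y, f h = h * e := by
    obtain ⟨g, hg, h⟩ := hLf e e.2.1
    refine ⟨g⁻¹, Y.inv_mem hg, ?_⟩
    rw [← h, map_inv]
    group
  choose h hhY hhe using hh
  let pt (p : Γ × E) : X := p.1 * h p.2
  have hptY (p : Γ × E) : pt p ∈ Y := Y.mul_mem p.1.2.1 (hhY _)
  have hptf (p : Γ × E) : f (pt p) = pt p * p.2 := by
    simp only [pt, map_mul, hhe, p.1.2.2, mul_assoc]
  have hpt : Function.Injective pt := by
    rintro p q hpq
    have h1 := hptf p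
    rw [hpq, hptf q] at h1
    have h2 : q.2 = p.2 := Subtype.ext (mul_left_cancel h1)
    refine Prod.ext (Subtype.ext ?_) h2.symm
    simp only [pt, h2] at hpq
    exact mul_right_cancel hpq
  let T (p : Γ × E) : Γ := ⟨pt p * (φ (pt p))⁻¹,
    Y.mul_mem (hptY p) (Y.inv_mem (hφY _ (hptY p))), by
      rw [map_mul, map_inv, hfφ, hptf, map_mul, p.2.2.2]
      group⟩
  have hcard : Fintype.card (Γ × E) ≤ Fintype.card E * (Finset.univ.image T).card := by
    rw [← Finset.card_univ]
    refine Finset.card_le_mul_card_image _ _ fun a ha ↦ ?_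
    obtain ⟨p₀, -, rfl⟩ := Finset.mem_image.1 ha
    rw [← Finset.card_univ]
    have hq (q : Γ × E) (hq : T q = T p₀) : (pt p₀)⁻¹ * pt q ∈ E := by
      refine ⟨Y.mul_mem (Y.inv_mem (hptY _)) (hptY _), ?_⟩
      have h1 : pt q * (φ (pt q))⁻¹ = pt p₀ * (φ (pt p₀))⁻¹ := congrArg Subtype.val hq
      have h2 := congrArg (fun z ↦ z⁻¹ * pt q) h1
      simp only [mul_inv_rev, inv_inv, inv_mul_cancel_right] at h2
      rw [map_mul, map_inv, h2]
      group
    refine Finset.card_le_card_of_injOn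
      (fun q ↦ if hq' : T q = T p₀ then ⟨_, hq q hq'⟩ else p₀.2) (fun _ _ ↦ Finset.mem_univ _) ?_
    intro q hq1 r hr1 hqr
    have hq2 : T q = T p₀ := (Finset.mem_filter.1 hq1).2
    have hr2 : T r = T p₀ := (Finset.mem_filter.1 hr1).2
    simp only [hq2, hr2, dif_pos] at hqr
    exact hpt (mul_left_cancel (congrArg Subtype.val hqr))
  have himage : Finset.univ.image T = Finset.univ := by
    apply Finset.eq_univ_of_card
    refine le_antisymm (Finset.card_le_univ _) ?_
    rw [Fintype.card_prod, mul_comm] at hcard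
    refine Nat.le_of_mul_le_mul_left hcard (Fintype.card_pos_iff.2 ⟨⟨1, Y.one_mem, map_one _⟩⟩)
  have hyΓ : y ∈ Γ := ⟨hy, by rw [hf]; exact hfS _ (Or.inl (Or.inl rfl))⟩
  obtain ⟨p, -, hp⟩ := Finset.mem_image.1 (himage ▸ Finset.mem_univ (⟨y, hyΓ⟩ : Γ))
  exact ⟨pt p, hptY p, congrArg Subtype.val hp⟩

section NullstellensatzLemmas

variable {Ω B : Type*} [Field Ω] [IsAlgClosed Ω] [CommRing B] [Algebra Ω B]
  [Algebra.FiniteType Ω B]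

/-- Weak Nullstellensatz for finite type algebras over an algebraically closed field. -/
theorem Ideal.IsMaximal.exists_algHom_ker_eq (m : Ideal B) [hm : m.IsMaximal] :
    ∃ χ : B →ₐ[Ω] Ω, RingHom.ker χ = m := by
  let : Field (B ⧸ m) := Ideal.Quotient.field m
  have : Module.Finite Ω (B ⧸ m) := finite_of_finite_type_of_isJacobsonRing Ω (B ⧸ m)
  have hbij := IsAlgClosed.algebraMap_bijective_of_isIntegral (k := Ω) (K := B ⧸ m)
  let e := AlgEquiv.ofBijective (Algebra.ofId Ω (B ⧸ m)) hbij
  refine ⟨(e.symm : (B ⧸ m) →ₐ[Ω] Ω).comp (Ideal.Quotient.mkₐ Ω m), ?_⟩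
  ext b
  simp [RingHom.mem_ker, Ideal.Quotient.eq_zero_iff_mem]

variable (Ω) in
theorem isNilpotent_of_forall_algHom_eq_zero (b : B) (h : ∀ χ : B →ₐ[Ω] Ω, χ b = 0) :
    IsNilpotent b := by
  have : IsJacobsonRing B := isJacobsonRing_of_finiteType (A := Ω)
  rw [← mem_nilradical, nilradical, Ideal.radical_eq_jacobson, Ideal.jacobson, Ideal.mem_sInf]
  rintro m ⟨-, hm⟩
  obtain ⟨χ, rfl⟩ := hm.exists_algHom_ker_eq (Ω := Ω)
  exact h χ

end NullstellensatzLemmas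

/-- The kernel of an integral endomorphism of a finite type algebra over a field is annihilated by a
nonzero element. -/
theorem RingHom.IsIntegral.exists_ne_zero_forall_mul_eq_zero (Ω : Type*) {B : Type*} [Field Ω]
    [CommRing B] [Algebra Ω B] [Algebra.FiniteType Ω B] [Nontrivial B] (f : B →+* B)
    (hf : f.IsIntegral) : ∃ h : B, h ≠ 0 ∧ ∀ a, f a = 0 → h * a = 0 := by
  have : IsNoetherianRing B := Algebra.FiniteType.isNoetherianRing Ω B
  have hdim : ringKrullDim B ≠ ⊤ := by
    obtain ⟨n, g, hg⟩ := Algebra.FiniteType.iff_quotient_mvPolynomial''.mp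
      ‹Algebra.FiniteType Ω B›
    have h1 := ringKrullDim_le_of_surjective g.toRingHom hg
    rw [MvPolynomial.ringKrullDim_of_isNoetherianRing, ringKrullDim_eq_zero_of_field] at h1
    intro h
    rw [h] at h1
    simp only [Nat.card_eq_fintype_card, Fintype.card_fin, zero_add, top_le_iff] at h1
    exact absurd h1 (by exact ne_of_lt (WithBot.coe_lt_coe.mpr (ENat.natCast_lt_top n)))
  have hdisj : ∀ r, f r = 0 → r ∉ nonZeroDivisors B := by
    intro r hr hreg
    have h1 := ringKrullDim_quotient_succ_le_of_nonZeroDivisor hreg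
    have h2 : ringKrullDim B ≤ ringKrullDim (B ⧸ Ideal.span {r}) := by
      let g : B ⧸ Ideal.span {r} →+* B := Ideal.Quotient.lift _ f (fun a ha ↦ by
        obtain ⟨c, rfl⟩ := Ideal.mem_span_singleton'.mp ha
        simp [hr])
      have hg : g.IsIntegral := RingHom.IsIntegral.tower_top (Ideal.Quotient.mk _) g (by
        convert hf
        ext x
        rfl)
      algebraize [g]
      refine Order.krullDim_le_of_strictMono (PrimeSpectrum.comap g) fun p q hpq ↦ ?_
      exact Ideal.IsIntegral.comap_lt_comap (R := B ⧸ Ideal.span {r}) (I := p.asIdeal)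
        (J := q.asIdeal) hpq
    have h3 : ringKrullDim B + 1 ≤ ringKrullDim B := (add_le_add_left h2 1).trans h1
    have h4 := ringKrullDim_nonneg_of_nontrivial (R := B)
    generalize ringKrullDim B = d at *
    induction d with
    | bot => simp at h4
    | coe d =>
      induction d with
      | top => exact hdim rfl
      | coe d =>
        norm_cast at h3
        omega
  have hsub : ((RingHom.ker f : Ideal B) : Set B) ⊆ ⋃ p ∈ associatedPrimes B B, (p : Set B) := by
    rw [biUnion_associatedPrimes_eq_compl_nonZeroDivisors]
    exact fun r hr ↦ hdisj r hr
  obtain ⟨P, hP, hle⟩ := (Ideal.subset_union_prime_finite (associatedPrimes.finite B B)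
    (f := fun p ↦ p) 0 0 fun _ h _ _ ↦ h.isPrime).1 hsub
  obtain ⟨hPp, h, hh⟩ := isAssociatedPrime_iff.mp hP
  refine ⟨h, ?_, fun a ha ↦ ?_⟩
  · rintro rfl
    exact hPp.ne_top (by rw [hh]; ext; simp [Submodule.mem_colon_singleton])
  · have : a ∈ P := hle ha
    rw [hh, Submodule.mem_colon_singleton, Submodule.mem_bot, smul_eq_mul] at this
    rw [mul_comm, this]

/-- A reduced noetherian ring has only finitely many idempotents. -/
theorem finite_setOf_isIdempotentElem (B : Type*) [CommRing B] [IsNoetherianRing B] [IsReduced B] :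
    {e : B | IsIdempotentElem e}.Finite := by
  have hfin := minimalPrimes.finite_of_isNoetherianRing B
  refine Set.Finite.of_finite_image (f := fun e ↦ {p ∈ minimalPrimes B | e ∈ p})
    (hfin.finite_subsets.subset ?_) ?_
  · rintro _ ⟨e, -, rfl⟩
    exact Set.sep_subset _ _
  · intro e he e' he' h
    have key : ∀ p ∈ minimalPrimes B, e - e' ∈ p := by
      intro p hp
      have hpp : p.IsPrime := hp.1.1
      have h1 : e ∈ p ↔ e' ∈ p := by
        have := Set.ext_iff.mp h p
        exact ⟨fun h1 ↦ (this.mp ⟨hp, h1⟩).2, fun h1 ↦ (this.mpr ⟨hp, h1⟩).2⟩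
      by_cases h2 : e ∈ p
      · exact p.sub_mem h2 (h1.mp h2)
      · have h3 : ∀ e : B, IsIdempotentElem e → e ∉ p → 1 - e ∈ p := fun e he hep ↦
          (hpp.mem_or_mem (x := e) (y := 1 - e) (by
            rw [mul_sub, mul_one, he.eq, sub_self]; exact p.zero_mem)).resolve_left hep
        have := p.sub_mem (h3 e' he' (h1.not.mp h2)) (h3 e he h2)
        simpa using this
    have h0 : e - e' ∈ sInf (minimalPrimes B) := by
      rw [Ideal.mem_sInf]; exact fun {p} hp ↦ key p hp
    rw [minimalPrimes, Ideal.sInf_minimalPrimes] at h0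
    have : IsNilpotent (e - e') := h0
    exact sub_eq_zero.mp this.eq_zero

/-- If the `Q`-th powers, `2 ≤ Q`, of finitely many algebra generators lie in the linear span of
the generators, then the algebra is finite. -/
theorem Module.Finite.of_pow_mem_span {S B ι : Type*} [CommRing S] [CommRing B] [Algebra S B]
    [Finite ι] (x : ι → B) (hx : Algebra.adjoin S (Set.range x) = ⊤) {Q : ℕ} (hQ : 2 ≤ Q)
    (h : ∀ i, x i ^ Q ∈ Submodule.span S (Set.range x)) : Module.Finite S B := by
  classical
  let mon (e : ι →₀ ℕ) : B := e.prod fun i n ↦ x i ^ n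
  have mon_add (e e') : mon (e + e') = mon e * mon e' :=
    Finsupp.prod_add_index' (by simp) (by simp [pow_add])
  have mon_single (i n) : mon (Finsupp.single i n) = x i ^ n := Finsupp.prod_single_index (by simp)
  let E : Set (ι →₀ ℕ) := Set.Iic (Finsupp.equivFunOnFinite.symm fun _ ↦ Q)
  let M := Submodule.span S (mon '' E)
  have key : ∀ n, ∀ e : ι →₀ ℕ, e.degree = n → mon e ∈ M := by
    intro n
    induction n using Nat.strong_induction_on with
    | _ n ih =>
      intro e he
      by_cases heE : e ∈ E
      · exact Submodule.subset_span ⟨e, heE, rfl⟩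
      obtain ⟨i, hi⟩ : ∃ i, Q ≤ e i := by
        by_contra! hcon
        exact heE fun i ↦ (hcon i).le
      obtain ⟨e', rfl⟩ : ∃ e', e = Finsupp.single i Q + e' :=
        ⟨e - Finsupp.single i Q, (add_tsub_cancel_of_le (by simpa using hi)).symm⟩
      have hmem : ∀ z ∈ Submodule.span S (Set.range x), z * mon e' ∈ M := by
        intro z hz
        induction hz using Submodule.span_induction with
        | mem z hz =>
          obtain ⟨j, rfl⟩ := hz
          have := ih (Finsupp.single j 1 + e').degree (by
            simp only [map_add, Finsupp.degree_single] at he ⊢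
            omega) _ rfl
          simpa [mon_add, mon_single] using this
        | zero => simp
        | add a b _ _ ha hb => rw [add_mul]; exact M.add_mem ha hb
        | smul c a _ ha => rw [smul_mul_assoc]; exact M.smul_mem c ha
      rw [mon_add, mon_single]
      exact hmem _ (h i)
  have hM : M = ⊤ := by
    rw [eq_top_iff]
    rintro b -
    have hb : b ∈ (MvPolynomial.aeval x : MvPolynomial ι S →ₐ[S] B).range := by
      rw [← Algebra.adjoin_range_eq_range_aeval, hx]; trivial
    obtain ⟨p, rfl⟩ := hb
    change MvPolynomial.aeval x p ∈ M
    rw [MvPolynomial.aeval_def, MvPolynomial.eval₂_eq]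
    refine Submodule.sum_mem _ fun e _ ↦ ?_
    rw [← Algebra.smul_def]
    exact M.smul_mem _ (key _ e rfl)
  have hE : E.Finite := (Set.finite_Icc 0 _).subset fun e he ↦ ⟨zero_le, he⟩
  exact ⟨⟨(hE.image mon).toFinset, by simpa [M] using hM⟩⟩

theorem AlgHom.isIntegral_of_pow_eq_sum {Ω S B ι : Type*} [CommRing Ω] [CommRing S] [CommRing B]
    [Algebra Ω S] [Algebra Ω B] [Fintype ι] (f : S →ₐ[Ω] B) (x : ι → B)
    (hx : Algebra.adjoin Ω (Set.range x) = ⊤) {Q : ℕ} (hQ : 2 ≤ Q) (c : ι → ι → S)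
    (h : ∀ i, x i ^ Q = ∑ j, f (c i j) * x j) : f.toRingHom.IsIntegral := by
  let := f.toRingHom.toAlgebra
  have : IsScalarTower Ω S B := .of_algebraMap_eq fun r ↦ (f.commutes r).symm
  have hx' : Algebra.adjoin S (Set.range x) = ⊤ := by
    rw [eq_top_iff]
    rintro b -
    have hb : b ∈ Algebra.adjoin Ω (Set.range x) := by rw [hx]; trivial
    have hle : Algebra.adjoin Ω (Set.range x) ≤
        (Algebra.adjoin S (Set.range x)).restrictScalars Ω :=
      Algebra.adjoin_le (Algebra.subset_adjoin (R := S) (s := Set.range x))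
    exact hle hb
  have := Module.Finite.of_pow_mem_span x hx' hQ fun i ↦ by
    have hsum : x i ^ Q = ∑ j, c i j • x j := by
      simp only [h, Algebra.smul_def, RingHom.algebraMap_toAlgebra]
      rfl
    rw [hsum]
    exact Submodule.sum_mem _ fun j _ ↦ Submodule.smul_mem _ _ (Submodule.subset_span ⟨j, rfl⟩)
  exact algebraMap_isIntegral_iff.mpr inferInstance

theorem RingHom.IsIntegral.exists_isMaximal_comap_eq {S B : Type*} [CommRing S] [CommRing B]
    {f : S →+* B} (hf : f.IsIntegral) (P : Ideal S) [P.IsMaximal] (hP : RingHom.ker f ≤ P) :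
    ∃ M : Ideal B, M.IsMaximal ∧ M.comap f = P := by
  algebraize [f]
  exact Ideal.exists_ideal_over_maximal_of_isIntegral P hP

open scoped Pointwise in
/-- An algebra of functions on a group which is noetherian and stable under translations and
inversion determines an identity component, the smallest subset containing `1` whose indicator
function lies in the algebra. -/
theorem exists_subgroup_indicator_mem_subset {X Ω : Type*} [Group X] [Field Ω]
    (O : Subalgebra Ω (X → Ω)) [IsNoetherianRing O]
    (hl : ∀ g, ∀ G ∈ O, (fun x ↦ G (g * x)) ∈ O) (hi : ∀ g, ∀ G ∈ O, (fun x ↦ G (x⁻¹ * g)) ∈ O) :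
    ∃ Y : Subgroup X, Y.Normal ∧ Y.FiniteIndex ∧ (Y : Set X).indicator 1 ∈ O ∧
      ∀ W : Set X, W.indicator 1 ∈ O → 1 ∈ W → (Y : Set X) ⊆ W := by
  classical
  let B : Set (Set X) := {W | W.indicator 1 ∈ O}
  have memB (W : Set X) : W ∈ B ↔ W.indicator 1 ∈ O := Iff.rfl
  have Bfin : B.Finite := by
    have : IsReduced O := isReduced_of_injective O.val Subtype.val_injective
    have h1 := finite_setOf_isIdempotentElem O
    refine Set.Finite.of_finite_image (f := fun W : Set X ↦ W.indicator (1 : X → Ω))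
      ((h1.image Subtype.val).subset ?_) fun W _ W' _ h ↦ ?_
    · rintro _ ⟨W, hW, rfl⟩
      refine ⟨⟨_, hW⟩, Subtype.ext (funext fun x ↦ ?_), rfl⟩
      by_cases hx : x ∈ W <;> simp [hx]
    · ext x
      have := congrFun h x
      by_cases hx : x ∈ W <;> by_cases hx' : x ∈ W' <;> simp_all
  have Bcompl : ∀ W ∈ B, Wᶜ ∈ B := fun W hW ↦ by
    rw [memB, Set.indicator_compl]
    exact O.sub_mem O.one_mem hW
  have Binter : ∀ W ∈ B, ∀ W' ∈ B, W ∩ W' ∈ B := fun W hW W' hW' ↦ by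
    rw [memB, Set.inter_indicator_one]
    exact O.mul_mem hW hW'
  have Bsmul : ∀ g : X, ∀ W ∈ B, g • W ∈ B := fun g W hW ↦ by
    rw [memB]
    convert hl g⁻¹ _ hW using 1
    ext x
    simp only [Set.indicator, Set.mem_smul_set_iff_inv_smul_mem, smul_eq_mul, Pi.one_apply]
  let Y : Subgroup X := ⨅ W : B, MulAction.stabilizer X W.1
  have memY (y : X) : y ∈ Y ↔ ∀ W ∈ B, y • W = W := by
    simp [Y, Subgroup.mem_iInf, MulAction.mem_stabilizer_iff]
  have subY : ∀ W ∈ B, 1 ∈ W → (Y : Set X) ⊆ W := fun W hW h1 y hy ↦ by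
    rw [← (memY y).mp hy W hW]
    exact ⟨1, h1, by simp⟩
  have memY' : ∀ y, (∀ W ∈ B, 1 ∈ W → y ∈ W) → y ∈ Y := fun y hy ↦ by
    refine (memY y).mpr fun W hW ↦ Set.ext fun x ↦ ?_
    rw [Set.mem_smul_set_iff_inv_smul_mem, smul_eq_mul]
    have hP : {z | z⁻¹ * x ∈ W} ∈ B := hi x _ hW
    by_cases hx : x ∈ W
    · exact iff_of_true (hy _ hP (by simpa using hx)) hx
    · exact iff_of_false (hy _ (Bcompl _ hP) (by simpa using hx)) hx
  have : Finite B := Bfin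
  refine ⟨Y, ⟨fun y hy g ↦ ?_⟩, ?_, ?_, subY⟩
  · rw [memY] at hy ⊢
    intro W hW
    rw [mul_smul, mul_smul, hy _ (Bsmul _ _ hW), smul_inv_smul]
  · refine Subgroup.finiteIndex_iInf fun W ↦ ⟨?_⟩
    rw [MulAction.index_stabilizer]
    have hfin : (MulAction.orbit X W.1).Finite := Bfin.subset (by
      rintro _ ⟨g, rfl⟩
      exact Bsmul g _ W.2)
    exact (Set.ncard_pos hfin).mpr ⟨_, MulAction.mem_orbit_self _⟩ |>.ne'
  · have hsub : {W ∈ B | 1 ∈ W}.Finite := Bfin.subset (Set.sep_subset _ _)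
    have hY : (Y : Set X) = ⋂₀ {W ∈ B | 1 ∈ W} := by
      refine Set.Subset.antisymm (Set.subset_sInter fun W hW ↦ subY W hW.1 hW.2) fun y hy ↦ ?_
      exact memY' y fun W hW h1 ↦ hy W ⟨hW, h1⟩
    have hall : ∀ S : Set (Set X), S.Finite → S ⊆ B → ⋂₀ S ∈ B := by
      intro S hS
      induction S, hS using Set.Finite.induction_on with
      | empty => 
        intro _
        rw [memB, Set.sInter_empty, Set.indicator_univ]
        exact O.one_mem
      | insert _ _ ih =>
        intro hSB
        rw [Set.sInter_insert]
        exact Binter _ (hSB (Set.mem_insert _ _)) _ (ih fun W hW ↦ hSB (Set.mem_insert_of_mem _ hW))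
    rw [hY]
    exact hall _ hsub (Set.sep_subset _ _)

namespace Points

open TensorProduct Coalgebra WithConv

variable {R H Ω : Type*} [CommRing R] [CommRing H] [HopfAlgebra R H] [Field Ω] [Algebra R Ω]

/-- The function on points defined by an element of the Hopf algebra. -/
def ev (h : H) : Points R H Ω → Ω := fun x ↦ x.ofConv h

variable (R H Ω) in
/-- The algebra of regular functions on the group of points. -/
def regular : Subalgebra Ω (Points R H Ω → Ω) := Algebra.adjoin Ω (Set.range ev)

theorem ev_mem_regular (h : H) : ev h ∈ regular R H Ω := Algebra.subset_adjoin ⟨h, rfl⟩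

/-- A self-map of the group of points is regular if it is given by regular functions. -/
def IsRegular (u : Points R H Ω → Points R H Ω) : Prop :=
  ∀ h : H, (fun x ↦ (u x).ofConv h) ∈ regular R H Ω

namespace IsRegular

variable {u w : Points R H Ω → Points R H Ω}

theorem comp_mem (hu : IsRegular u) {G : Points R H Ω → Ω} (hG : G ∈ regular R H Ω) :
    (fun x ↦ G (u x)) ∈ regular R H Ω := by
  induction hG using Algebra.adjoin_induction with
  | mem G hG => obtain ⟨h, rfl⟩ := hG; exact hu h
  | algebraMap c => exact (regular R H Ω).algebraMap_mem c
  | add G G' _ _ h h' => exact (regular R H Ω).add_mem h h'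
  | mul G G' _ _ h h' => exact (regular R H Ω).mul_mem h h'

theorem id : IsRegular fun x : Points R H Ω ↦ x := ev_mem_regular

theorem const (g : Points R H Ω) : IsRegular fun _ : Points R H Ω ↦ g :=
  fun h ↦ (regular R H Ω).algebraMap_mem (g.ofConv h)

theorem inv (hu : IsRegular u) : IsRegular fun x ↦ (u x)⁻¹ :=
  fun h ↦ hu (HopfAlgebra.antipode R h)

theorem mul (hu : IsRegular u) (hw : IsRegular w) : IsRegular fun x ↦ u x * w x := by
  intro h
  simp only [mul_ofConv_apply]
  generalize comul (R := R) h = t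
  induction t with
  | zero => simp only [map_zero]; exact (regular R H Ω).zero_mem
  | add s t hs ht => simp only [map_add]; exact (regular R H Ω).add_mem hs ht
  | tmul a b =>
    simp only [Algebra.TensorProduct.lift_tmul]; exact (regular R H Ω).mul_mem (hu a) (hw b)

theorem pull (ψ : H →ₐ[R] H) (hψ) (hu : IsRegular u) : IsRegular fun x ↦ pull ψ hψ (u x) :=
  fun h ↦ hu (ψ h)

theorem push_frobenius (Fr : Ω →ₐ[R] Ω) {Q : ℕ} (hFr : ∀ z, Fr z = z ^ Q) (hu : IsRegular u) :
    IsRegular fun x ↦ push Fr (u x) := by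
  intro h
  simp only [push_ofConv, AlgHom.comp_apply, hFr]
  exact (regular R H Ω).pow_mem (hu h) Q

/-- The comorphism of a regular map. -/
def comorphism (hu : IsRegular u) : regular R H Ω →ₐ[Ω] regular R H Ω where
  toFun G := ⟨fun x ↦ G.1 (u x), hu.comp_mem G.2⟩
  map_one' := rfl
  map_mul' _ _ := rfl
  map_zero' := rfl
  map_add' _ _ := rfl
  commutes' _ := rfl

end IsRegular

/-- Evaluation of regular functions at a point. -/
def evalRegular (x : Points R H Ω) : regular R H Ω →ₐ[Ω] Ω :=
  (Pi.evalAlgHom Ω (fun _ ↦ Ω) x).comp (regular R H Ω).val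

theorem evalRegular_surjective :
    Function.Surjective (evalRegular : Points R H Ω → regular R H Ω →ₐ[Ω] Ω) := by
  intro χ
  let e : H →ₐ[R] Points R H Ω → Ω := AlgHom.pi fun x ↦ x.ofConv
  let e' : H →ₐ[R] regular R H Ω := e.codRestrict ((regular R H Ω).restrictScalars R)
    fun h ↦ ev_mem_regular h
  refine ⟨toConv ((χ.restrictScalars R).comp e'), AlgHom.ext fun ⟨G, hG⟩ ↦ ?_⟩
  induction hG using Algebra.adjoin_induction with
  | mem G hG => obtain ⟨h, rfl⟩ := hG; rfl
  | algebraMap c => exact (AlgHom.commutes _ c).trans (AlgHom.commutes χ c).symm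
  | add G G' hG hG' h h' =>
    exact (map_add _ (⟨G, hG⟩ : regular R H Ω) ⟨G', hG'⟩).trans
      ((congrArg₂ _ h h').trans (map_add χ _ _).symm)
  | mul G G' hG hG' h h' =>
    exact (map_mul _ (⟨G, hG⟩ : regular R H Ω) ⟨G', hG'⟩).trans
      ((congrArg₂ _ h h').trans (map_mul χ _ _).symm)

variable {ι : Type*} {v : ι → H} (hv : Algebra.adjoin R (Set.range v) = ⊤)

include hv in
theorem adjoin_ev : Algebra.adjoin Ω (Set.range fun i ↦ ev (v i)) = regular R H Ω := by
  refine le_antisymm (Algebra.adjoin_mono ?_) (Algebra.adjoin_le ?_)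
  · rintro _ ⟨i, rfl⟩; exact ⟨_, rfl⟩
  · rintro _ ⟨h, rfl⟩
    let e : H →ₐ[R] Points R H Ω → Ω := AlgHom.pi fun x ↦ x.ofConv
    have hle : Algebra.adjoin R (Set.range v) ≤
        ((Algebra.adjoin Ω (Set.range fun i ↦ ev (Ω := Ω) (v i))).restrictScalars R).comap e := by
      refine Algebra.adjoin_le ?_
      rintro _ ⟨i, rfl⟩
      exact Algebra.subset_adjoin ⟨i, rfl⟩
    rw [hv] at hle
    exact hle (Algebra.mem_top : h ∈ ⊤)

include hv in
theorem finiteType_regular [Finite ι] : Algebra.FiniteType Ω (regular R H Ω) := by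
  rw [← Subalgebra.fg_iff_finiteType]
  exact ⟨(Set.finite_range fun i ↦ ev (v i)).toFinset, by simpa using adjoin_ev hv⟩

include hv in
theorem adjoin_ev_subtype :
    Algebra.adjoin Ω (Set.range fun i ↦ (⟨ev (v i), ev_mem_regular _⟩ : regular R H Ω)) = ⊤ := by
  apply Subalgebra.map_injective (f := (regular R H Ω).val) Subtype.val_injective
  rw [AlgHom.map_adjoin, ← Set.range_comp, Algebra.map_top, Subalgebra.range_val]
  exact adjoin_ev hv

end Points

namespace Points

open TensorProduct Coalgebra WithConv

variable {R H Ω : Type*} [CommRing R] [CommRing H] [HopfAlgebra R H] [Field Ω] [Algebra R Ω]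

/-- The Lang map of a Frobenius endomorphism of the group of points has an integral comorphism. -/
theorem isIntegral_comorphism_frobenius {ι : Type*} [Fintype ι] {v : ι → H}
    (hv : Algebra.adjoin R (Set.range v) = ⊤) (C : ι → ι → H)
    (hC : ∀ i, comul (R := R) (v i) = ∑ j, C i j ⊗ₜ[R] v j) (Fr : Ω →ₐ[R] Ω) {Q : ℕ} (hQ : 2 ≤ Q)
    (hFr : ∀ z, Fr z = z ^ Q)
    (hu : IsRegular fun g : Points R H Ω ↦ g * (push Fr g)⁻¹) :
    hu.comorphism.toRingHom.IsIntegral := by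
  let x (i : ι) : regular R H Ω := ⟨ev (v i), ev_mem_regular _⟩
  let c (i j : ι) : regular R H Ω := ⟨ev (HopfAlgebra.antipode R (C i j)), ev_mem_regular _⟩
  refine AlgHom.isIntegral_of_pow_eq_sum hu.comorphism x (adjoin_ev_subtype hv) hQ c fun i ↦ ?_
  ext g
  have h1 : (push Fr g).ofConv (v i) = ((g * (push Fr g)⁻¹)⁻¹ * g).ofConv (v i) := by
    congr 2; group
  rw [mul_ofConv_apply, hC, map_sum] at h1
  simp only [Algebra.TensorProduct.lift_tmul, push_ofConv, AlgHom.comp_apply, hFr] at h1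
  refine h1.trans ?_
  simp only [AddSubmonoidClass.coe_finsetSum, Finset.sum_apply]
  rfl

theorem indicator_range_lang_frobenius_mem [IsAlgClosed Ω] {ι : Type*} [Fintype ι] {v : ι → H}
    (hv : Algebra.adjoin R (Set.range v) = ⊤) (C : ι → ι → H)
    (hC : ∀ i, comul (R := R) (v i) = ∑ j, C i j ⊗ₜ[R] v j) (Fr : Ω →ₐ[R] Ω) {Q : ℕ} (hQ : 2 ≤ Q)
    (hFr : ∀ z, Fr z = z ^ Q) :
    (Set.range fun g : Points R H Ω ↦ g * (push Fr g)⁻¹).indicator 1 ∈ regular R H Ω := by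
  have hFreg : IsRegular fun g : Points R H Ω ↦ push Fr g := .push_frobenius Fr hFr .id
  have hu : IsRegular fun g : Points R H Ω ↦ g * (push Fr g)⁻¹ := .mul .id hFreg.inv
  have hint := isIntegral_comorphism_frobenius hv C hC Fr hQ hFr hu
  have := finiteType_regular (Ω := Ω) hv
  set U := Set.range fun g : Points R H Ω ↦ g * (push Fr g)⁻¹
  let K : Ideal (regular R H Ω) := RingHom.ker hu.comorphism.toRingHom
  have hK (a : regular R H Ω) : a ∈ K ↔ ∀ x ∈ U, a.1 x = 0 := by
    rw [Set.forall_mem_range]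
    exact ⟨fun h x ↦ congrFun (congrArg Subtype.val (show hu.comorphism a = 0 from h)) x,
      fun h ↦ Subtype.ext (funext h)⟩
  have hmemU (x) (hx : ∀ a ∈ K, a.1 x = 0) : x ∈ U := by
    have hmax : (RingHom.ker (evalRegular x)).IsMaximal :=
      RingHom.ker_isMaximal_of_surjective _ fun c ↦ ⟨algebraMap _ _ c, AlgHom.commutes _ c⟩
    obtain ⟨M, hM, hMx⟩ := hint.exists_isMaximal_comap_eq (RingHom.ker (evalRegular x))
      (fun a ha ↦ hx a ha)
    obtain ⟨χ, rfl⟩ := hM.exists_algHom_ker_eq (Ω := Ω)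
    obtain ⟨g, rfl⟩ := evalRegular_surjective χ
    refine ⟨g, WithConv.ofConv_injective (AlgHom.ext fun h ↦ ?_)⟩
    let a : regular R H Ω := ⟨ev h, ev_mem_regular h⟩
    have h1 : a - algebraMap Ω _ (x.ofConv h) ∈ RingHom.ker (evalRegular x) := by
      rw [RingHom.mem_ker, map_sub, AlgHom.commutes]
      exact sub_self _
    rw [← hMx] at h1
    exact sub_eq_zero.mp h1
  obtain ⟨h, hh0, hh⟩ := hint.exists_ne_zero_forall_mul_eq_zero Ω
  obtain ⟨g₀, hg₀⟩ : ∃ g, h.1 g ≠ 0 := by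
    by_contra! hcon
    exact hh0 (Subtype.ext (funext hcon))
  have hU (x) (hx : h.1 x ≠ 0) : x ∈ U := hmemU x fun a ha ↦
    (mul_eq_zero.mp (congrFun (congrArg Subtype.val (hh a ha)) x)).resolve_left hx
  let t (g : Points R H Ω) : regular R H Ω := ⟨fun x ↦ h.1 (g⁻¹ * x * push Fr g),
    (IsRegular.mul (.mul (.const _) .id) (.const _)).comp_mem h.2⟩
  have ht (x) : x ∈ U ↔ ∃ g, (t g).1 x ≠ 0 := by
    constructor
    · rintro ⟨g, rfl⟩
      obtain ⟨g', hg'⟩ := hU g₀ hg₀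
      refine ⟨g * g'⁻¹, ?_⟩
      change h.1 ((g * g'⁻¹)⁻¹ * (g * (push Fr g)⁻¹) * push Fr (g * g'⁻¹)) ≠ 0
      convert hg₀ using 2
      rw [← hg']
      simp only [map_mul, map_inv]
      group
    · rintro ⟨g, hg⟩
      obtain ⟨g', hg'⟩ := hU _ hg
      refine ⟨g * g', ?_⟩
      have : x = g * (g⁻¹ * x * push Fr g) * (push Fr g)⁻¹ := by group
      rw [this, ← hg']
      simp only [map_mul]
      group
  have htop : K ⊔ Ideal.span (Set.range t) = ⊤ := by
    by_contra hne
    obtain ⟨M, hM, hle⟩ := Ideal.exists_le_maximal _ hne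
    obtain ⟨χ, rfl⟩ := hM.exists_algHom_ker_eq (Ω := Ω)
    obtain ⟨x, rfl⟩ := evalRegular_surjective χ
    rw [sup_le_iff, Ideal.span_le] at hle
    obtain ⟨g, hg⟩ := (ht x).mp (hmemU x fun a ha ↦ hle.1 ha)
    exact hg (hle.2 ⟨g, rfl⟩)
  obtain ⟨a, ha, b, hb, hab⟩ := Submodule.mem_sup.mp
    (show (1 : regular R H Ω) ∈ K ⊔ Ideal.span (Set.range t) by rw [htop]; trivial)
  have hb0 (x) (hx : x ∉ U) : b.1 x = 0 := by
    have : Ideal.span (Set.range t) ≤ RingHom.ker (evalRegular x) := by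
      rw [Ideal.span_le]
      rintro _ ⟨g, rfl⟩
      by_contra hcon
      exact hx ((ht x).mpr ⟨g, hcon⟩)
    exact this hb
  have : U.indicator 1 = b.1 := by
    funext x
    have h1 : a.1 x + b.1 x = 1 := congrFun (congrArg Subtype.val hab) x
    by_cases hx : x ∈ U
    · rw [(hK a).mp ha x hx, zero_add] at h1
      rw [Set.indicator_of_mem hx, h1]; rfl
    · rw [Set.indicator_of_notMem hx, hb0 x hx]
  rw [this]
  exact b.2

end Points

namespace Points

open TensorProduct Coalgebra WithConv

variable {R H Ω : Type*} [CommRing R] [CommRing H] [HopfAlgebra R H] [Field Ω] [Algebra R Ω]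

theorem exists_apply_ne_zero_of_indicator_mem [IsAlgClosed Ω] [Algebra.FiniteType R H] (f : H)
    (hf : ∀ t : Ω ⊗[R] H, (1 ⊗ₜ[R] f) * t = 0 → t = 0) (W : Set (Points R H Ω)) (hW : W.Nonempty)
    (hWreg : W.indicator 1 ∈ regular R H Ω) : ∃ z ∈ W, z.ofConv f ≠ 0 := by
  by_contra! hcon
  let E (x : Points R H Ω) : Ω ⊗[R] H →ₐ[Ω] Ω :=
    Algebra.TensorProduct.lift (AlgHom.id Ω Ω) x.ofConv fun _ _ ↦ .all ..
  let Θ : Ω ⊗[R] H →ₐ[Ω] Points R H Ω → Ω := AlgHom.pi E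
  have hle : regular R H Ω ≤ Θ.range := Algebra.adjoin_le (by
    rintro _ ⟨h, rfl⟩
    exact ⟨1 ⊗ₜ h, funext fun x ↦ by simp [Θ, E, ev]⟩)
  obtain ⟨t, ht⟩ := hle hWreg
  have ht (x) : E x t = W.indicator 1 x := congrFun ht x
  have hnil : IsNilpotent ((1 ⊗ₜ[R] f : Ω ⊗[R] H) * t) := by
    refine isNilpotent_of_forall_algHom_eq_zero Ω _ fun χ ↦ ?_
    obtain ⟨x, rfl⟩ : ∃ x, χ = E x := by
      refine ⟨toConv ((χ.restrictScalars R).comp Algebra.TensorProduct.includeRight), ?_⟩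
      ext h
      simp [E]
    rw [map_mul, ht]
    by_cases hx : x ∈ W
    · simp [E, hcon x hx]
    · simp [hx]
  obtain ⟨n, hn⟩ := hnil
  have htn : t ^ n = 0 := by
    rw [mul_pow] at hn
    have : ∀ m s, (1 ⊗ₜ[R] f : Ω ⊗[R] H) ^ m * s = 0 → s = 0 := by
      intro m
      induction m with
      | zero => simp
      | succ m ih => intro s hs; rw [pow_succ, mul_assoc] at hs; exact hf _ (ih _ hs)
    exact this n _ hn
  obtain ⟨x, hx⟩ := hW
  have := congrArg (E x) htn
  rw [map_pow, ht, Set.indicator_of_mem hx, map_zero] at this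
  simp at this

theorem push_pow_frobenius (Fr : Ω →ₐ[R] Ω) {q : ℕ} (hFr : ∀ z, Fr z = z ^ q) (m : ℕ) (z : Ω) :
    (Fr ^ m) z = z ^ q ^ m := by
  induction m generalizing z with
  | zero => simp
  | succ m ih => rw [pow_succ', AlgHom.mul_apply, ih, hFr, ← pow_mul, pow_succ]

theorem iterate_push (Fr : Ω →ₐ[R] Ω) (m : ℕ) (x : Points R H Ω) :
    (push Fr)^[m] x = push (Fr ^ m) x := by
  induction m with
  | zero => rfl
  | succ m ih => rw [Function.iterate_succ_apply', ih, pow_succ']; rfl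

/-- **Lang–Steinberg theorem** over the algebraic closure of a finite field, for a group scheme
that need not be connected, under the assumption that the Lang map is dominant. -/
theorem lang_surjective [IsAlgClosed Ω] {ι : Type*} [Fintype ι] {v : ι → H}
    (hv : Algebra.adjoin R (Set.range v) = ⊤) (C : ι → ι → H)
    (hC : ∀ i, comul (R := R) (v i) = ∑ j, C i j ⊗ₜ[R] v j) (Fr : Ω →ₐ[R] Ω) {q : ℕ} (hq : 2 ≤ q)
    (hFr : ∀ z, Fr z = z ^ q) (hΩ : ∀ z : Ω, ∃ m, 0 < m ∧ z ^ q ^ m = z) (ψ : H →ₐ[R] H)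
    (hψ : comul ∘ₗ ψ.toLinearMap =
      TensorProduct.map ψ.toLinearMap ψ.toLinearMap ∘ₗ comul (R := R) (A := H))
    (hfix : {x : Points R H Ω | pull ψ hψ x = x}.Finite) (f : H)
    (hf : ∀ t : Ω ⊗[R] H, (1 ⊗ₜ[R] f) * t = 0 → t = 0)
    (hdom : ∀ x : Points R H Ω, x.ofConv f ≠ 0 → ∃ g, g * (pull ψ hψ g)⁻¹ = x)
    (x : Points R H Ω) : ∃ g, g * (pull ψ hψ g)⁻¹ = x := by
  have : Algebra.FiniteType R H := ⟨⟨(Set.finite_range v).toFinset, by simpa using hv⟩⟩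
  have := finiteType_regular (Ω := Ω) hv
  have : IsNoetherianRing (regular R H Ω) := Algebra.FiniteType.isNoetherianRing Ω _
  have hpt {x y : Points R H Ω} (h : ∀ i, x.ofConv (v i) = y.ofConv (v i)) : x = y :=
    WithConv.ofConv_injective (AlgHom.ext_of_adjoin_eq_top hv (by rintro _ ⟨i, rfl⟩; exact h i))
  have hq1 (m : ℕ) (hm : 0 < m) : 2 ≤ q ^ m := hq.trans (Nat.le_self_pow hm.ne' q)
  obtain ⟨Y, hYn, hYf, hYreg, hYmin⟩ := exists_subgroup_indicator_mem_subset (regular R H Ω)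
    (fun g G hG ↦ (IsRegular.mul (.const g) .id).comp_mem hG)
    (fun g G hG ↦ (IsRegular.mul (.inv .id) (.const g)).comp_mem hG)
  have hφY : ∀ y ∈ Y, pull ψ hψ y ∈ Y := fun y hy ↦
    hYmin (pull ψ hψ ⁻¹' Y) ((IsRegular.pull ψ hψ .id).comp_mem hYreg) (by simp) hy
  have hLangY := lang_surjOn_of_frobenius (push Fr) (pull ψ hψ) (fun _ ↦ rfl) ?_ ?_ hfix Y hφY ?_
  rotate_left
  · intro x
    choose m hm0 hm using hΩ
    refine ⟨∏ i, m (x.ofConv (v i)), Finset.prod_pos fun i _ ↦ hm0 _, ?_⟩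
    rw [iterate_push]
    refine hpt fun i ↦ ?_
    rw [push_ofConv, AlgHom.comp_apply, push_pow_frobenius Fr hFr]
    obtain ⟨c, hc⟩ := Finset.dvd_prod_of_mem (fun i ↦ m (x.ofConv (v i))) (Finset.mem_univ i)
    rw [hc, pow_mul]
    have hiter : ∀ c : ℕ, x.ofConv (v i) ^ (q ^ m (x.ofConv (v i))) ^ c = x.ofConv (v i) := by
      intro c
      induction c with
      | zero => simp
      | succ c ih => rw [pow_succ, pow_mul, ih, hm]
    exact hiter c
  · intro m hm
    have hroots : {z : Ω | z ^ q ^ m = z}.Finite := by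
      have hp : (Polynomial.X ^ q ^ m - Polynomial.X : Polynomial Ω) ≠ 0 :=
        (FiniteField.X_pow_card_sub_X_ne_zero Ω (hq1 m hm))
      refine (Polynomial.finite_setOfPred_isRoot hp).subset fun z hz ↦ ?_
      simpa [sub_eq_zero] using hz
    refine Set.Finite.of_finite_image (f := fun x i ↦ x.ofConv (v i))
      ((Set.Finite.pi' fun _ ↦ hroots).subset ?_) fun x _ y _ h ↦ hpt (congrFun h)
    rintro _ ⟨x, hx, rfl⟩ i
    have := congrArg (fun x : Points R H Ω ↦ x.ofConv (v i)) ((iterate_push Fr m x).symm.trans hx)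
    rwa [push_ofConv, AlgHom.comp_apply, push_pow_frobenius Fr hFr] at this
  · intro m hm y hy
    simp only [iterate_push]
    exact hYmin _ (indicator_range_lang_frobenius_mem hv C hC (Fr ^ m) (hq1 m hm)
      (push_pow_frobenius Fr hFr m)) ⟨1, by simp⟩ hy
  obtain ⟨z, hz, hzf⟩ := exists_apply_ne_zero_of_indicator_mem f hf {z | x⁻¹ * z ∈ Y}
    ⟨x, by simp⟩ ((IsRegular.mul (.const x⁻¹) .id).comp_mem hYreg)
  obtain ⟨g, hg⟩ := hdom z hzf
  have hmem : g⁻¹ * (x * z⁻¹) * g ∈ Y := by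
    have h1 : z⁻¹ * x ∈ Y := by simpa using Y.inv_mem hz
    have h2 := hYn.conj_mem _ h1 (g⁻¹ * z)
    convert h2 using 1
    group
  obtain ⟨u, -, hu⟩ := hLangY _ hmem
  refine ⟨g * u, ?_⟩
  have : g * u * (pull ψ hψ (g * u))⁻¹ =
      g * (u * (pull ψ hψ u)⁻¹) * g⁻¹ * (g * (pull ψ hψ g)⁻¹) := by
    rw [map_mul]; group
  rw [this, hu, hg]
  group

end Points

section Comodule

open TensorProduct Coalgebra

/-- Every element of a coalgebra over a field lies in the span of a finite set which spans a left
coideal. -/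
theorem Coalgebra.exists_finset_comul_eq {k A : Type*} [Field k] [AddCommGroup A] [Module k A]
    [Coalgebra k A] (a : A) : ∃ T : Finset A, a ∈ Submodule.span k (T : Set A) ∧
      ∀ t ∈ T, ∃ C : A → A, comul (R := k) t = ∑ w ∈ T, C w ⊗ₜ[k] w := by
  classical
  let e := Module.Basis.ofVectorSpace k A
  obtain ⟨b, hb⟩ := TensorProduct.eq_repr_basis_left e (comul (R := k) a)
  let D (α) : A ⊗[k] A →ₗ[k] A := _root_.TensorProduct.lid k A ∘ₗ LinearMap.rTensor A (e.coord α)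
  have hD (α) (x y : A) : D α (x ⊗ₜ y) = e.coord α x • y := by simp [D]
  have hbD (α) : b α = D α (comul a) := by
    rw [← hb, Finsupp.sum, map_sum]
    simp only [hD, Module.Basis.coord_apply, Module.Basis.repr_self, Finsupp.single_apply, ite_smul,
      one_smul, zero_smul, Finset.sum_ite_eq', Finsupp.mem_support_iff]
    by_cases h : b α = 0 <;> simp [h]
  have hcomul (α) : comul (R := k) (b α) = ∑ β ∈ b.support, D α (comul (e β)) ⊗ₜ b β := by
    have h1 (t : A ⊗[k] A) : comul (R := k) (D α t) =
        _root_.TensorProduct.lid k _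
          (LinearMap.rTensor _ (e.coord α) (LinearMap.lTensor A comul t)) := by
      induction t with
      | zero => simp
      | add x y hx hy => simp only [map_add, hx, hy]
      | tmul x y => simp [hD]
    have h2 (t : (A ⊗[k] A) ⊗[k] A) : _root_.TensorProduct.lid k _ (LinearMap.rTensor _ (e.coord α)
        (_root_.TensorProduct.assoc k A A A t)) = LinearMap.rTensor A (D α) t := by
      induction t with
      | zero => simp
      | add x y hx hy => simp only [map_add, hx, hy]
      | tmul x y =>
        induction x with
        | zero => simp
        | add x z hx hz => simp only [TensorProduct.add_tmul, map_add, hx, hz]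
        | tmul x z => simp [hD, TensorProduct.smul_tmul']
    rw [hbD, h1, ← coassoc_apply, h2, ← hb, Finsupp.sum, map_sum, map_sum]
    simp
  refine ⟨b.support.image b, ?_, ?_⟩
  · have h := rTensor_counit_comul (R := k) a
    rw [← hb, Finsupp.sum, map_sum] at h
    have h' := congrArg (_root_.TensorProduct.lid k A) h
    simp only [LinearMap.rTensor_tmul, map_sum, _root_.TensorProduct.lid_tmul, one_smul] at h'
    rw [← h']
    exact Submodule.sum_mem _ fun i hi ↦ Submodule.smul_mem _ _
      (Submodule.subset_span (Finset.mem_coe.mpr (Finset.mem_image_of_mem b hi)))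
  · intro t ht
    obtain ⟨α, -, rfl⟩ := Finset.mem_image.mp ht
    refine ⟨fun w ↦ ∑ β ∈ b.support with b β = w, D α (comul (e β)), ?_⟩
    rw [hcomul, ← Finset.sum_fiberwise_of_maps_to (g := b) (t := b.support.image b)
      fun i hi ↦ Finset.mem_image_of_mem _ hi]
    refine Finset.sum_congr rfl fun w _ ↦ ?_
    rw [TensorProduct.sum_tmul]
    refine Finset.sum_congr rfl fun β hβ ↦ ?_
    rw [(Finset.mem_filter.mp hβ).2]

/-- A finite type algebra with a coalgebra structure over a field has a finite generating set
spanning a left coideal. -/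
theorem Coalgebra.exists_finset_adjoin_eq_top {k A : Type*} [Field k] [CommRing A] [Algebra k A]
    [Coalgebra k A] [hA : Algebra.FiniteType k A] :
    ∃ T : Finset A, Algebra.adjoin k (T : Set A) = ⊤ ∧
      ∀ t ∈ T, ∃ C : A → A, comul (R := k) t = ∑ w ∈ T, C w ⊗ₜ[k] w := by
  classical
  obtain ⟨S, hS⟩ := hA.1
  choose T hspan hT using Coalgebra.exists_finset_comul_eq (k := k) (A := A)
  refine ⟨S.biUnion T, ?_, fun t ht ↦ ?_⟩
  · rw [eq_top_iff, ← hS, Algebra.adjoin_le_iff]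
    intro a ha
    refine Algebra.span_le_adjoin k _ (Submodule.span_mono ?_ (hspan a))
    exact Finset.coe_subset.mpr (Finset.subset_biUnion_of_mem T ha)
  · obtain ⟨a, ha, hta⟩ := Finset.mem_biUnion.mp ht
    obtain ⟨C, hC⟩ := hT a t hta
    refine ⟨fun w ↦ if w ∈ T a then C w else 0, ?_⟩
    simp only [ite_tmul]
    rw [hC, ← Finset.sum_filter]
    congr 1
    ext w
    simp only [Finset.mem_filter, Finset.mem_biUnion]
    exact ⟨fun h ↦ ⟨⟨a, ha, h⟩, h⟩, fun h ↦ h.2⟩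

end Comodule

theorem Int.isJacobsonRing : IsJacobsonRing ℤ := by
  refine isJacobsonRing_iff_prime_eq.mpr fun P hP ↦ ?_
  by_cases h : P = ⊥
  · subst h
    refine eq_bot_iff.mpr fun x hx ↦ ?_
    have := Int.isUnit_iff.mp (Ideal.mem_jacobson_bot.mp hx x)
    have hx0 : x = 0 := mul_self_eq_zero.mp (by
      rcases this with h | h <;> nlinarith [mul_self_nonneg x])
    simp [hx0]
  · have := hP.isMaximal h
    exact Ideal.jacobson_eq_self_of_isMaximal

/-- A field which is a finite type `ℤ`-algebra is finite. -/
theorem Field.finite_of_finiteType_int (F : Type*) [Field F] [Algebra.FiniteType ℤ F] :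
    Finite F := by
  have := Int.isJacobsonRing
  have : Module.Finite ℤ F := finite_of_finite_type_of_isJacobsonRing ℤ F
  obtain ⟨p, hp⟩ := CharP.exists F
  rcases CharP.char_is_prime_or_zero F p with hprime | rfl
  · have : Fact p.Prime := ⟨hprime⟩
    let := ZMod.algebra F p
    have : Module.Finite (ZMod p) F := .of_restrictScalars_finite ℤ _ _
    exact Module.finite_of_finite (ZMod p)
  · have := CharP.charP_to_charZero F
    exact absurd (isField_of_isIntegral_of_isField (R := ℤ) (S := F)
      (RingHom.injective_int (algebraMap ℤ F)) (Field.toIsField F)) Int.not_isField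

/-- An injective endomorphism of a finite type domain over a field is algebraic. -/
theorem AlgHom.exists_polynomial_eval₂_eq_zero {k A : Type*} [Field k] [CommRing A] [IsDomain A]
    [Algebra k A] [Algebra.FiniteType k A] (L : A →ₐ[k] A) (hL : Function.Injective L) (a : A) :
    ∃ p : Polynomial A, p ≠ 0 ∧ p.eval₂ L.toRingHom a = 0 := by
  obtain ⟨s, hs⟩ := exists_isTranscendenceBasis k A
  have hfin : Algebra.trdeg k A < Cardinal.aleph0 := trdeg_lt_aleph0_of_finiteType
  have hs' : IsTranscendenceBasis k (fun i : s ↦ L i) :=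
    (hs.1.map' hL).isTranscendenceBasis_of_trdeg_le hfin hs.cardinalMk_eq_trdeg.ge
  obtain ⟨p, hp0, hp⟩ := hs'.isAlgebraic.1 a
  have hsub : Algebra.adjoin k (Set.range fun i : s ↦ L i) ≤ L.range :=
    Algebra.adjoin_le (by rintro _ ⟨i, rfl⟩; exact ⟨i, rfl⟩)
  let e := AlgEquiv.ofInjective L hL
  let j : Algebra.adjoin k (Set.range fun i : s ↦ L i) →+* A :=
    (e.symm.toAlgHom.comp (Subalgebra.inclusion hsub)).toRingHom
  have hj : L.toRingHom.comp j = algebraMap _ A := RingHom.ext fun x ↦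
    congrArg Subtype.val (e.apply_symm_apply (Subalgebra.inclusion hsub x))
  refine ⟨p.map j, ?_, ?_⟩
  · rwa [Ne, Polynomial.map_eq_zero_iff]
    exact e.symm.injective.comp (Subalgebra.inclusion_injective hsub)
  · rw [Polynomial.eval₂_map, hj]
    exact hp

/-- Homomorphisms to algebraically closed fields extend along injective integral extensions. -/
theorem RingHom.exists_comp_algebraMap_eq_of_isIntegral {B C Ω : Type*} [CommRing B] [CommRing C]
    [Algebra B C] [Algebra.IsIntegral B C] [FaithfulSMul B C] [Field Ω] [IsAlgClosed Ω]
    (x : B →+* Ω) : ∃ g : C →+* Ω, g.comp (algebraMap B C) = x := by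
  have := ker_isPrime x
  obtain ⟨Q, -, hQ, hQx⟩ := Ideal.exists_ideal_over_prime_of_isIntegral (S := C) (ker x) ⊥
    (by rw [← RingHom.ker_eq_comap_bot, (ker_eq_bot_iff_eq_zero (algebraMap B C)).mpr]
        · exact bot_le
        · exact fun b hb ↦ (FaithfulSMul.algebraMap_injective B C) (by rw [hb, map_zero]))
  have : Q.LiesOver (ker x) := ⟨hQx.symm⟩
  let : Algebra (B ⧸ ker x) Ω := (kerLift x).toAlgebra
  have : FaithfulSMul (B ⧸ ker x) Ω := (faithfulSMul_iff_algebraMap_injective _ _).mpr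
    (kerLift_injective x)
  have : Algebra.IsIntegral (B ⧸ ker x) (C ⧸ Q) :=
    Ideal.Quotient.algebra_isIntegral_of_liesOver Q (ker x)
  have : Module.IsTorsionFree (B ⧸ ker x) (C ⧸ Q) :=
    Module.isTorsionFree_iff_faithfulSMul.mpr inferInstance
  have : Module.IsTorsionFree (B ⧸ ker x) Ω :=
    Module.isTorsionFree_iff_faithfulSMul.mpr inferInstance
  let g : C ⧸ Q →ₐ[B ⧸ ker x] Ω := IsAlgClosed.lift
  refine ⟨g.toRingHom.comp (Ideal.Quotient.mk Q), RingHom.ext fun b ↦ ?_⟩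
  exact g.commutes (Ideal.Quotient.mk _ b)

/-- A homomorphism to an algebraically closed field extends along an injective finite type
extension if it does not kill the leading coefficients of polynomials with the given generators
as roots. -/
theorem RingHom.exists_comp_algebraMap_eq_of_leadingCoeff {B C Ω ι : Type*} [CommRing B]
    [CommRing C] [Algebra B C] [FaithfulSMul B C] [Field Ω] [IsAlgClosed Ω] {v : ι → C}
    (hv : Algebra.adjoin B (Set.range v) = ⊤) (p : ι → Polynomial B)
    (hp : ∀ i, (p i).eval₂ (algebraMap B C) (v i) = 0) (x : B →+* Ω)
    (hx : ∀ i, x (p i).leadingCoeff ≠ 0) : ∃ g : C →+* Ω, g.comp (algebraMap B C) = x := by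
  have := ker_isPrime x
  let M := (ker x).primeCompl
  let C' := Localization (M.map (algebraMap B C))
  let j : Localization M →+* C' := IsLocalization.map C' (algebraMap B C) M.le_comap_map
  have hj : Function.Injective j :=
    IsLocalization.map_injective_of_injective M _ C' (FaithfulSMul.algebraMap_injective B C)
  let := j.toAlgebra
  let D := integralClosure (Localization M) C'
  have : FaithfulSMul (Localization M) D := (faithfulSMul_iff_algebraMap_injective _ _).mpr
    fun a b h ↦ hj (congrArg Subtype.val h)
  have hjB (b : B) : j (algebraMap B _ b) = algebraMap C C' (algebraMap B C b) :=
    IsLocalization.map_eq _ _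
  have hCD (c : C) : algebraMap C C' c ∈ D := by
    have hc : c ∈ Algebra.adjoin B (Set.range v) := hv ▸ trivial
    induction hc using Algebra.adjoin_induction with
    | mem c hc =>
      obtain ⟨i, rfl⟩ := hc
      exact isIntegralElem_localization_at_leadingCoeff (algebraMap B C) (v i) (p i) (hp i) M
        (hx i)
    | algebraMap b => rw [← hjB]; exact D.algebraMap_mem _
    | add a b _ _ ha hb => rw [map_add]; exact D.add_mem ha hb
    | mul a b _ _ ha hb => rw [map_mul]; exact D.mul_mem ha hb
  obtain ⟨g, hg⟩ := exists_comp_algebraMap_eq_of_isIntegral (C := D)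
    (IsLocalization.lift (M := M) (S := Localization M) (g := x) fun m ↦ IsUnit.mk0 _ m.2)
  refine ⟨g.comp ((algebraMap C C').codRestrict D hCD), RingHom.ext fun b ↦ ?_⟩
  refine Eq.trans ?_ (IsLocalization.lift_eq (M := M) (S := Localization M)
    (g := x) (fun m ↦ IsUnit.mk0 _ m.2) b)
  rw [← hg]
  exact congrArg g (Subtype.ext (hjB b).symm)

section SpreadingOut

open Filter

variable {k A ι : Type*} [Field k] [CommRing A] [Algebra k A]

/-- The finitely generated subring generated by a finite set of scalars. -/
abbrev spreadRing (s : Finset k) : Subalgebra ℤ k := Algebra.adjoin ℤ (s : Set k)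

/-- The model over `spreadRing s` generated by the family `v`. -/
abbrev spreadAlgebra (v : ι → A) (s : Finset k) : Subalgebra (spreadRing s) A :=
  Algebra.adjoin (spreadRing s) (Set.range v)

theorem eventually_mem_spreadRing (c : k) : ∀ᶠ s : Finset k in atTop, c ∈ spreadRing s := by
  filter_upwards [eventually_ge_atTop {c}] with s hs
  exact Algebra.subset_adjoin (hs (Finset.mem_singleton_self c))

theorem eventually_mem_spreadAlgebra {v : ι → A} (hv : Algebra.adjoin k (Set.range v) = ⊤) (a : A) :
    ∀ᶠ s : Finset k in atTop, a ∈ spreadAlgebra v s := by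
  have ha : a ∈ Algebra.adjoin k (Set.range v) := hv ▸ trivial
  induction ha using Algebra.adjoin_induction with
  | mem a ha => exact .of_forall fun s ↦ Algebra.subset_adjoin ha
  | algebraMap c =>
    filter_upwards [eventually_mem_spreadRing c] with s hs
    exact (spreadAlgebra v s).algebraMap_mem ⟨c, hs⟩
  | add a b _ _ ha hb => filter_upwards [ha, hb] with s ha hb using add_mem ha hb
  | mul a b _ _ ha hb => filter_upwards [ha, hb] with s ha hb using mul_mem ha hb

theorem eventually_coeff_mem_spreadRing (p : MvPolynomial ι k) : ∀ᶠ s : Finset k in atTop,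
    p ∈ (MvPolynomial.map (algebraMap (spreadRing s) k)).range := by
  have : ∀ᶠ s : Finset k in atTop, ∀ e ∈ p.support, p.coeff e ∈ spreadRing s :=
    (eventually_all_finset _).mpr fun e _ ↦ eventually_mem_spreadRing _
  filter_upwards [this] with s hs
  rw [p.as_sum]
  exact sum_mem fun e he ↦ ⟨MvPolynomial.monomial e ⟨_, hs e he⟩, by simp⟩

/-- A consequence of the existence of Gröbner bases: generically over the base, a finite type
algebra and its quotient by an element are free on the same set of monomials. -/
theorem exists_monomials_generic [Finite ι] {v : ι → A} (hv : Algebra.adjoin k (Set.range v) = ⊤)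
    (f : A) : ∃ M : Set (ι →₀ ℕ),
      LinearIndependent k (fun e : M ↦ Ideal.Quotient.mk (Ideal.span {f})
        (MvPolynomial.aeval v (MvPolynomial.monomial e.1 (1 : k)))) ∧
      ∀ᶠ s : Finset k in atTop, ∀ h ∈ spreadAlgebra v s, ∃ h' ∈ spreadAlgebra v s,
        ∃ r ∈ Submodule.span (spreadRing s)
          (Set.range fun e : M ↦ MvPolynomial.aeval v (MvPolynomial.monomial e.1 (1 : k))),
        h = f * h' + r := by
  classical
  let : LinearOrder ι := linearOrderOfSTO WellOrderingRel
  let m : MonomialOrder ι := MonomialOrder.lex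
  let I : Ideal (MvPolynomial ι k) := (Ideal.span {f}).comap (MvPolynomial.aeval v)
  let S : Set (ι →₀ ℕ) := {e | ∃ p ∈ I, p ≠ 0 ∧ m.degree p = e}
  let T : Set (ι →₀ ℕ) := {e | Minimal (· ∈ S) e}
  have hT : T.Finite := WellQuasiOrderedLE.finite_of_isAntichain (setOfPred_minimal_antichain _)
  have hp (e : T) : ∃ p ∈ I, m.Monic p ∧ m.degree p = e := by
    obtain ⟨p, hpI, hp0, hpe⟩ := e.2.prop
    have hlc : m.leadingCoeff p ≠ 0 := m.leadingCoeff_ne_zero_iff.mpr hp0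
    refine ⟨MvPolynomial.C (m.leadingCoeff p)⁻¹ * p, I.mul_mem_left _ hpI, ?_, ?_⟩
    · rw [MonomialOrder.Monic, MonomialOrder.leadingCoeff_mul, MonomialOrder.leadingCoeff_C,
        inv_mul_cancel₀ hlc]
    · rw [m.degree_mul (by simpa using hp0) hp0, MonomialOrder.degree_C, zero_add, hpe]
  choose p hpI hpm hpd using hp
  have ha (e : T) : ∃ a, MvPolynomial.aeval v (p e) = f * a := by
    obtain ⟨a, ha⟩ := Ideal.mem_span_singleton.mp (hpI e)
    exact ⟨a, ha⟩
  choose a ha using ha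
  refine ⟨{c | ∀ e ∈ T, ¬ e ≤ c}, ?_, ?_⟩
  · rw [linearIndependent_iff]
    intro l hl
    let q : MvPolynomial ι k := l.sum fun e c ↦ MvPolynomial.monomial e.1 c
    have hcoeff (d) : q.coeff d = l.sum fun e c ↦ if e.1 = d then c else 0 := by
      simp [q, Finsupp.sum, MvPolynomial.coeff_sum, MvPolynomial.coeff_monomial]
    have hqI : q ∈ I := by
      rw [Ideal.mem_comap, ← Ideal.Quotient.eq_zero_iff_mem, ← hl, Finsupp.linearCombination_apply]
      simp only [q, Finsupp.sum, map_sum]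
      refine Finset.sum_congr rfl fun e _ ↦ ?_
      rw [← mul_one (l e), ← smul_eq_mul, ← MvPolynomial.smul_monomial, map_smul, smul_eq_mul,
        mul_one]
      rfl
    have hq0 : q = 0 := by
      by_contra hq0
      obtain ⟨e, hle, he⟩ := exists_minimal_le_of_wellFoundedLT (· ∈ S) (m.degree q)
        ⟨q, hqI, hq0, rfl⟩
      have hd := (m.coeff_degree_ne_zero_iff (f := q)).mpr hq0
      rw [hcoeff] at hd
      obtain ⟨d, -, hd⟩ := Finset.exists_ne_zero_of_sum_ne_zero hd
      obtain ⟨h, -⟩ := ite_ne_right_iff.mp hd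
      exact d.2 e he (h ▸ hle)
    ext e
    have := hcoeff e.1
    rw [hq0, MvPolynomial.coeff_zero, Finsupp.sum] at this
    simpa [Subtype.ext_iff.symm] using this.symm
  · have : Finite T := hT
    have h1 : ∀ᶠ s : Finset k in atTop, ∀ e, a e ∈ spreadAlgebra v s :=
      eventually_all.mpr fun e ↦ eventually_mem_spreadAlgebra hv _
    have h2 : ∀ᶠ s : Finset k in atTop, ∀ e,
        p e ∈ (MvPolynomial.map (algebraMap (spreadRing s) k)).range :=
      eventually_all.mpr fun e ↦ eventually_coeff_mem_spreadRing _
    filter_upwards [h1, h2] with s h1 h2 h hh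
    rw [spreadAlgebra, Algebra.adjoin_range_eq_range_aeval] at hh
    obtain ⟨P, rfl⟩ := hh
    choose p' hp' using h2
    have hinj : Function.Injective (algebraMap (spreadRing s) k) := Subtype.val_injective
    have hdeg (e) : m.degree (p' e) = e.1 := by
      rw [← hpd e, ← hp' e]
      simp [MonomialOrder.degree, MvPolynomial.support_map_of_injective _ hinj]
    have hmonic (e) : m.leadingCoeff (p' e) = 1 := by
      refine hinj ?_
      have := hpm e
      rw [MonomialOrder.Monic, MonomialOrder.leadingCoeff, hpd, ← hp',
        MvPolynomial.coeff_map] at this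
      rw [MonomialOrder.leadingCoeff, hdeg, this, map_one]
    obtain ⟨g, r, hP, -, hr⟩ := m.div_set (B := Set.range p')
      (by rintro _ ⟨e, rfl⟩; rw [hmonic]; exact isUnit_one) P
    have hmap (Q : MvPolynomial ι (spreadRing s)) : MvPolynomial.aeval v Q =
        MvPolynomial.aeval v (MvPolynomial.map (algebraMap (spreadRing s) k) Q) := by
      rw [MvPolynomial.aeval_map_algebraMap]
    have hmem (Q : MvPolynomial ι (spreadRing s)) : MvPolynomial.aeval v Q ∈ spreadAlgebra v s := by
      rw [spreadAlgebra, Algebra.adjoin_range_eq_range_aeval]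
      exact ⟨Q, rfl⟩
    have hg (g) : ∃ h' ∈ spreadAlgebra v s, MvPolynomial.aeval v (Finsupp.linearCombination
        (MvPolynomial ι (spreadRing s)) (fun b : Set.range p' ↦ b.1) g) = f * h' := by
      induction g using Finsupp.induction_linear with
      | zero => exact ⟨0, zero_mem _, by simp⟩
      | add g₁ g₂ h₁ h₂ =>
        obtain ⟨x, hx, hx'⟩ := h₁
        obtain ⟨y, hy, hy'⟩ := h₂
        exact ⟨x + y, add_mem hx hy, by rw [map_add, map_add, hx', hy', mul_add]⟩
      | single b c =>
        obtain ⟨_, e, rfl⟩ := b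
        refine ⟨MvPolynomial.aeval v c * a e, mul_mem (hmem c) (h1 e), ?_⟩
        rw [Finsupp.linearCombination_single, smul_eq_mul, map_mul, hmap (p' e), hp', ha]
        ring
    obtain ⟨h', hh', hg⟩ := hg g
    refine ⟨h', hh', MvPolynomial.aeval v r, ?_, ?_⟩
    · rw [r.as_sum, map_sum]
      refine sum_mem fun c hc ↦ ?_
      rw [← mul_one (r.coeff c), ← smul_eq_mul, ← MvPolynomial.smul_monomial, map_smul]
      refine Submodule.smul_mem _ _ (Submodule.subset_span ⟨⟨c, fun e he hec ↦ ?_⟩, ?_⟩)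
      · exact hr c hc _ ⟨⟨e, he⟩, rfl⟩ ((hdeg ⟨e, he⟩).trans_le hec)
      · simp [MvPolynomial.aeval_monomial]
    · rw [← hg, ← map_add, ← hP]
      rfl

end SpreadingOut

section Descent

open TensorProduct Coalgebra

/-- The comparison map from a tensor product over a ring to one over an extension. -/
noncomputable def tensorComparison {R k A₁ A₂ B₁ B₂ : Type*} [CommRing R] [CommRing k]
    [Algebra R k] [CommRing A₁] [Algebra k A₁] [Algebra R A₁] [IsScalarTower R k A₁] [CommRing A₂]
    [Algebra k A₂] [Algebra R A₂] [IsScalarTower R k A₂] [CommRing B₁] [Algebra R B₁]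
    [CommRing B₂] [Algebra R B₂] (j₁ : B₁ →ₐ[R] A₁) (j₂ : B₂ →ₐ[R] A₂) :
    B₁ ⊗[R] B₂ →ₐ[R] A₁ ⊗[k] A₂ :=
  Algebra.TensorProduct.lift (Algebra.TensorProduct.includeLeft.comp j₁)
    ((Algebra.TensorProduct.includeRight.restrictScalars R).comp j₂) fun _ _ ↦ .all ..

@[simp] theorem tensorComparison_tmul {R k A₁ A₂ B₁ B₂ : Type*} [CommRing R] [CommRing k]
    [Algebra R k] [CommRing A₁] [Algebra k A₁] [Algebra R A₁] [IsScalarTower R k A₁] [CommRing A₂]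
    [Algebra k A₂] [Algebra R A₂] [IsScalarTower R k A₂] [CommRing B₁] [Algebra R B₁]
    [CommRing B₂] [Algebra R B₂] (j₁ : B₁ →ₐ[R] A₁) (j₂ : B₂ →ₐ[R] A₂) (x : B₁) (y : B₂) :
    tensorComparison (k := k) j₁ j₂ (x ⊗ₜ y) = j₁ x ⊗ₜ j₂ y := by
  simp [tensorComparison]

/-- A linear map over a subring sends a basis to a family linearly independent over the field. -/
def IsForm (R k : Type u) {N V : Type u} [CommRing R] [Field k] [AddCommGroup N] [Module R N]
    [AddCommGroup V] [Module k V] (j : N → V) : Prop :=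
  ∃ (κ : Type u) (b : Module.Basis κ R N), LinearIndependent k (j ∘ b)

theorem IsForm.injective {R N V k : Type u} [CommRing R] [Field k] [Algebra R k] [FaithfulSMul R k]
    [AddCommGroup N] [Module R N] [AddCommGroup V] [Module k V] [Module R V] [IsScalarTower R k V]
    {j : N →ₗ[R] V} (hj : IsForm R k j) : Function.Injective j := by
  obtain ⟨κ, b, hb⟩ := hj
  have h := hb.restrict_scalars (R := R) (by
    simpa only [← Algebra.algebraMap_eq_smul_one] using FaithfulSMul.algebraMap_injective R k)
  rw [← LinearMap.ker_eq_bot, LinearMap.ker_eq_bot']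
  intro x hx
  rw [← b.linearCombination_repr x, Finsupp.apply_linearCombination] at hx
  have := linearIndependent_iff.mp h _ hx
  simpa using this

theorem IsForm.tmul {R k N₁ N₂ V₁ V₂ : Type u} [CommRing R] [Field k] [AddCommGroup N₁]
    [Module R N₁] [AddCommGroup V₁] [Module k V₁] [AddCommGroup N₂] [Module R N₂] [AddCommGroup V₂]
    [Module k V₂] {j₁ : N₁ → V₁} {j₂ : N₂ → V₂} (hj₁ : IsForm R k j₁) (hj₂ : IsForm R k j₂)
    {j : N₁ ⊗[R] N₂ → V₁ ⊗[k] V₂} (hj : ∀ x y, j (x ⊗ₜ y) = j₁ x ⊗ₜ j₂ y) : IsForm R k j := by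
  obtain ⟨κ₁, b₁, hb₁⟩ := hj₁
  obtain ⟨κ₂, b₂, hb₂⟩ := hj₂
  refine ⟨κ₁ × κ₂, b₁.tensorProduct b₂, ?_⟩
  have h : j ∘ b₁.tensorProduct b₂ = fun i ↦ (j₁ ∘ b₁) i.1 ⊗ₜ (j₂ ∘ b₂) i.2 := by
    ext ⟨i₁, i₂⟩
    simp [hj]
  rw [h]
  exact hb₁.tmul_of_isDomain hb₂

section HopfAlgebra

variable {R k A B : Type*} [CommRing R] [CommRing k] [Algebra R k] [CommRing A]
  [HopfAlgebra k A] [Algebra R A] [IsScalarTower R k A] [CommRing B] [Algebra R B] (j : B →ₐ[R] A)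
  (hj : Function.Injective j)
  (hj₂ : Function.Injective (tensorComparison (k := k) j j))
  (hj₃ : Function.Injective (tensorComparison (k := k) j (tensorComparison (k := k) j j)))
  (Δ : B →ₐ[R] B ⊗[R] B) (hΔ : ∀ b, tensorComparison (k := k) j j (Δ b) = comul (R := k) (j b))
  (ε : B →ₐ[R] R) (hε : ∀ b, algebraMap R k (ε b) = counit (R := k) (j b))
  (S : B →ₗ[R] B) (hS : ∀ b, j (S b) = HopfAlgebra.antipode k (j b))

include hj₃ hΔ in
theorem ofForm_coassoc : ((Algebra.TensorProduct.assoc R R R B B B).toAlgHom).comp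
    ((Algebra.TensorProduct.map Δ (AlgHom.id R B)).comp Δ) =
      (Algebra.TensorProduct.map (AlgHom.id R B) Δ).comp Δ := by
  refine AlgHom.ext fun b ↦ hj₃ ?_
  have h1 (u : B ⊗[R] B) (y : B) : tensorComparison (k := k) j (tensorComparison (k := k) j j)
      (Algebra.TensorProduct.assoc R R R B B B (u ⊗ₜ y)) =
        _root_.TensorProduct.assoc k A A A (tensorComparison (k := k) j j u ⊗ₜ j y) := by
    induction u with
    | zero => simp
    | add x z hx hz => simp only [TensorProduct.add_tmul, map_add, hx, hz]
    | tmul x z => simp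
  have h2 (t : B ⊗[R] B) : tensorComparison (k := k) j (tensorComparison (k := k) j j)
      (Algebra.TensorProduct.assoc R R R B B B (Algebra.TensorProduct.map Δ (AlgHom.id R B) t)) =
        _root_.TensorProduct.assoc k A A A (comul.rTensor A (tensorComparison (k := k) j j t)) := by
    induction t with
    | zero => simp
    | add x z hx hz => simp only [map_add, hx, hz]
    | tmul x z => simp [h1, hΔ]
  have h3 (t : B ⊗[R] B) : tensorComparison (k := k) j (tensorComparison (k := k) j j)
      (Algebra.TensorProduct.map (AlgHom.id R B) Δ t) =
        comul.lTensor A (tensorComparison (k := k) j j t) := by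
    induction t with
    | zero => simp
    | add x z hx hz => simp only [map_add, hx, hz]
    | tmul x z => simp [hΔ]
  refine (h2 (Δ b)).trans (Eq.trans ?_ (h3 (Δ b)).symm)
  rw [hΔ, coassoc_apply]

include hj hΔ hε in
theorem ofForm_rTensor_counit : (Algebra.TensorProduct.map ε (AlgHom.id R B)).comp Δ =
    (Algebra.TensorProduct.lid R B).symm.toAlgHom := by
  refine AlgHom.ext fun b ↦ (Algebra.TensorProduct.lid R B).injective (hj ?_)
  have h (t : B ⊗[R] B) : j (Algebra.TensorProduct.lid R B
      (Algebra.TensorProduct.map ε (AlgHom.id R B) t)) =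
        _root_.TensorProduct.lid k A (counit.rTensor A (tensorComparison (k := k) j j t)) := by
    induction t with
    | zero => simp
    | add x z hx hz => simp only [map_add, hx, hz]
    | tmul x z => simp [← hε]
  refine (h (Δ b)).trans ?_
  simp [hΔ]

include hj hΔ hε in
theorem ofForm_lTensor_counit : (Algebra.TensorProduct.map (AlgHom.id R B) ε).comp Δ =
    (Algebra.TensorProduct.rid R R B).symm.toAlgHom := by
  refine AlgHom.ext fun b ↦ (Algebra.TensorProduct.rid R R B).injective (hj ?_)
  have h (t : B ⊗[R] B) : j (Algebra.TensorProduct.rid R R B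
      (Algebra.TensorProduct.map (AlgHom.id R B) ε t)) =
        _root_.TensorProduct.rid k A (counit.lTensor A (tensorComparison (k := k) j j t)) := by
    induction t with
    | zero => simp
    | add x z hx hz => simp only [map_add, hx, hz]
    | tmul x z => simp [← hε]
  refine (h (Δ b)).trans ?_
  simp [hΔ]

/-- Restriction of a Hopf algebra structure to a form over a subring. -/
noncomputable abbrev HopfAlgebra.ofForm : HopfAlgebra R B :=
  letI : Bialgebra R B := Bialgebra.ofAlgHom Δ ε (ofForm_coassoc j hj₃ Δ hΔ)
    (ofForm_rTensor_counit j hj Δ hΔ ε hε) (ofForm_lTensor_counit j hj Δ hΔ ε hε)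
  { antipode := S
    mul_antipode_rTensor_comul := by
      refine LinearMap.ext fun b ↦ hj ?_
      have h (t : B ⊗[R] B) : j (LinearMap.mul' R B (S.rTensor B t)) = LinearMap.mul' k A
          ((HopfAlgebra.antipode k).rTensor A (tensorComparison (k := k) j j t)) := by
        induction t with
        | zero => simp
        | add x z hx hz => simp only [map_add, hx, hz]
        | tmul x z => simp [hS]
      refine (h (Δ b)).trans ?_
      rw [hΔ, HopfAlgebra.mul_antipode_rTensor_comul_apply, ← hε, ← IsScalarTower.algebraMap_apply]
      exact (j.commutes _).symm
    mul_antipode_lTensor_comul := by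
      refine LinearMap.ext fun b ↦ hj ?_
      have h (t : B ⊗[R] B) : j (LinearMap.mul' R B (S.lTensor B t)) = LinearMap.mul' k A
          ((HopfAlgebra.antipode k).lTensor A (tensorComparison (k := k) j j t)) := by
        induction t with
        | zero => simp
        | add x z hx hz => simp only [map_add, hx, hz]
        | tmul x z => simp [hS]
      refine (h (Δ b)).trans ?_
      rw [hΔ, HopfAlgebra.mul_antipode_lTensor_comul_apply, ← hε, ← IsScalarTower.algebraMap_apply]
      exact (j.commutes _).symm }

end HopfAlgebra

section Compatibility

variable {R k A B : Type*} [CommRing R] [CommRing k] [Algebra R k] [CommRing A]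
  [HopfAlgebra k A] [Algebra R A] [IsScalarTower R k A] [CommRing B] [HopfAlgebra R B]
  (j : B →ₐ[R] A)
  (hΔ : ∀ b, tensorComparison (k := k) j j (comul (R := R) b) = comul (R := k) (j b))
  {ψ : A →ₐ[k] A} {χ : B →ₐ[R] B} (hχ : ∀ b, j (χ b) = ψ (j b))

include hΔ hχ in
theorem comul_comp_of_tensorComparison (hj₂ : Function.Injective (tensorComparison (k := k) j j))
    (hψ : comul ∘ₗ ψ.toLinearMap =
      TensorProduct.map ψ.toLinearMap ψ.toLinearMap ∘ₗ comul (R := k) (A := A)) :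
    comul ∘ₗ χ.toLinearMap =
      TensorProduct.map χ.toLinearMap χ.toLinearMap ∘ₗ comul (R := R) (A := B) := by
  refine LinearMap.ext fun b ↦ hj₂ ?_
  have h (t : B ⊗[R] B) : tensorComparison (k := k) j j
      (TensorProduct.map χ.toLinearMap χ.toLinearMap t) =
        TensorProduct.map ψ.toLinearMap ψ.toLinearMap (tensorComparison (k := k) j j t) := by
    induction t with
    | zero => simp
    | add x z hx hz => simp only [map_add, hx, hz]
    | tmul x z => simp [hχ]
  refine Eq.trans ?_ (h _).symm
  rw [hΔ]
  refine Eq.trans ?_ (LinearMap.congr_fun hψ (j b))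
  change tensorComparison (k := k) j j (comul (χ b)) = comul (ψ (j b))
  rw [hΔ, hχ]

include hΔ hχ in
theorem map_langHom (hS : ∀ b, j (HopfAlgebra.antipode R b) = HopfAlgebra.antipode k (j b))
    (b : B) : j (Points.langHom χ b) = Points.langHom ψ (j b) := by
  have h (t : B ⊗[R] B) : j (LinearMap.mul' R B (TensorProduct.map LinearMap.id
      (χ.toLinearMap ∘ₗ HopfAlgebra.antipode R) t)) = LinearMap.mul' k A
        (TensorProduct.map LinearMap.id (ψ.toLinearMap ∘ₗ HopfAlgebra.antipode k)
          (tensorComparison (k := k) j j t)) := by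
    induction t with
    | zero => simp
    | add x z hx hz => simp only [map_add, hx, hz]
    | tmul x z => simp [hχ, hS]
  rw [Points.langHom_apply, Points.langHom_apply, h, hΔ]

end Compatibility

end Descent

section Descent

open TensorProduct

/-- An injective linear map with projective cokernel stays injective after tensoring. -/
theorem LinearMap.lTensor_injective_of_projective_cokernel {R N N' : Type*} [CommRing R]
    [AddCommGroup N] [Module R N] [AddCommGroup N'] [Module R N'] (f : N →ₗ[R] N')
    (hf : Function.Injective f) [Module.Projective R (N' ⧸ LinearMap.range f)] (P : Type*)
    [AddCommGroup P] [Module R P] : Function.Injective (f.lTensor P) := by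
  obtain ⟨s, hs⟩ := Module.projective_lifting_property (LinearMap.range f).mkQ .id
    (Submodule.mkQ_surjective _)
  have hex : Function.Exact f (LinearMap.range f).mkQ := LinearMap.exact_map_mkQ_range f
  have hs' : ∃ l, (LinearMap.range f).mkQ ∘ₗ l = LinearMap.id := ⟨s, hs⟩
  have hl' : ∃ l, l ∘ₗ f = LinearMap.id :=
    ((hex.split_tfae hf (Submodule.mkQ_surjective _)).out 0 1).mp hs'
  obtain ⟨l, hl⟩ := hl'
  refine Function.LeftInverse.injective (g := l.lTensor P) fun t ↦ ?_
  rw [← LinearMap.comp_apply, ← LinearMap.lTensor_comp, hl, LinearMap.lTensor_id,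
    LinearMap.id_apply]

theorem tmul_mul_eq_zero_of_free {R k A B κ : Type*} [CommRing R] [Field k]
    [Algebra R k] [FaithfulSMul R k] [CommRing A] [IsDomain A] [Algebra k A] [Algebra R A]
    [IsScalarTower R k A] [CommRing B] [Algebra R B] (j : B →ₐ[R] A) (hj : Function.Injective j)
    {f : B} (hf : f ≠ 0) {w : κ → B}
    (hw : LinearIndependent k fun e ↦ Ideal.Quotient.mk (Ideal.span {j f}) (j (w e)))
    (hspan : ∀ h : B, ∃ h', ∃ r ∈ Submodule.span R (Set.range w), h = f * h' + r)
    {Ω : Type*} [CommRing Ω] [Algebra R Ω] (t : Ω ⊗[R] B) (ht : (1 ⊗ₜ[R] f) * t = 0) : t = 0 := by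
  let m : B →ₗ[R] B := LinearMap.mulLeft R f
  have hm : Function.Injective m := fun a b hab ↦ hj <| by
    have := congrArg j hab
    simpa [m, (map_ne_zero_iff j hj).mpr hf] using this
  let N := B ⧸ LinearMap.range m
  let q : N →ₗ[R] A ⧸ Ideal.span {j f} := (LinearMap.range m).liftQ
    ((Ideal.Quotient.mkₐ R (Ideal.span {j f})).comp j).toLinearMap <| by
      rintro _ ⟨b, rfl⟩
      simp [m]
  have hli : LinearIndependent R fun e ↦ (LinearMap.range m).mkQ (w e) := by
    refine LinearIndependent.of_comp q ?_
    refine hw.restrict_scalars (R := R) ?_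
    simpa only [← Algebra.algebraMap_eq_smul_one] using FaithfulSMul.algebraMap_injective R k
  have hsp : ⊤ ≤ Submodule.span R (Set.range fun e ↦ (LinearMap.range m).mkQ (w e)) := by
    rintro x -
    obtain ⟨h, rfl⟩ := Submodule.mkQ_surjective _ x
    obtain ⟨h', r, hr, rfl⟩ := hspan h
    have h0 : (LinearMap.range m).mkQ (f * h') = 0 :=
      (Submodule.Quotient.mk_eq_zero _).mpr ⟨h', rfl⟩
    rw [map_add, h0, zero_add]
    have := Submodule.mem_map_of_mem (f := (LinearMap.range m).mkQ) hr
    rwa [Submodule.map_span, ← Set.range_comp] at this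
  have : Module.Free R N := .of_basis (.mk hli hsp)
  have hmul (t : Ω ⊗[R] B) : m.lTensor Ω t = (1 ⊗ₜ[R] f) * t := by
    induction t with
    | zero => simp
    | add x z hx hz => rw [map_add, hx, hz, mul_add]
    | tmul x z => simp [m]
  exact LinearMap.lTensor_injective_of_projective_cokernel m hm Ω
    (by rw [map_zero, hmul, ht])

theorem isForm_of_linearIndependent {R k A B κ : Type u} [CommRing R] [Field k]
    [Algebra R k] [FaithfulSMul R k] [CommRing A] [Algebra k A] [Algebra R A]
    [IsScalarTower R k A] [CommRing B] [Algebra R B] (j : B →ₐ[R] A) {w : κ → B}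
    (hw : LinearIndependent k fun e ↦ j (w e))
    (hspan : ∀ h : B, h ∈ Submodule.span R (Set.range w)) : IsForm R k j := by
  have hli : LinearIndependent R w := by
    refine LinearIndependent.of_comp j.toLinearMap ?_
    refine hw.restrict_scalars (R := R) ?_
    simpa only [← Algebra.algebraMap_eq_smul_one] using FaithfulSMul.algebraMap_injective R k
  refine ⟨κ, .mk hli fun x _ ↦ hspan x, ?_⟩
  rwa [Module.Basis.coe_mk]

end Descent

section Descent

open TensorProduct Coalgebra

theorem AlgHom.exists_comp_eq_of_leadingCoeff {R B C Ω ι : Type*} [CommRing R] [CommRing B]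
    [Algebra R B] [CommRing C] [Algebra R C] [Field Ω] [Algebra R Ω] [IsAlgClosed Ω]
    {ℓ : B →ₐ[R] C} (hℓ : Function.Injective ℓ) {v : ι → C}
    (hv : Algebra.adjoin R (Set.range v) = ⊤) (p : ι → Polynomial B)
    (hp : ∀ i, (p i).eval₂ ℓ.toRingHom (v i) = 0) (x : B →ₐ[R] Ω)
    (hx : ∀ i, x (p i).leadingCoeff ≠ 0) : ∃ g : C →ₐ[R] Ω, g.comp ℓ = x := by
  let : Algebra B C := ℓ.toRingHom.toAlgebra
  have : FaithfulSMul B C := (faithfulSMul_iff_algebraMap_injective B C).mpr hℓ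
  have hv' : Algebra.adjoin B (Set.range v) = ⊤ := by
    refine eq_top_iff.mpr fun b _ ↦ ?_
    have hb : b ∈ Algebra.adjoin R (Set.range v) := hv ▸ trivial
    induction hb using Algebra.adjoin_induction with
    | mem b hb => exact Algebra.subset_adjoin hb
    | algebraMap r =>
      have : algebraMap R C r = algebraMap B C (algebraMap R B r) := (ℓ.commutes r).symm
      rw [this]
      exact Subalgebra.algebraMap_mem _ _
    | add a b _ _ ha hb => exact add_mem (ha trivial) (hb trivial)
    | mul a b _ _ ha hb => exact mul_mem (ha trivial) (hb trivial)
  obtain ⟨g, hg⟩ := RingHom.exists_comp_algebraMap_eq_of_leadingCoeff hv' p hp x.toRingHom hx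
  have hg' (b : B) : g (ℓ b) = x b := RingHom.congr_fun hg b
  refine ⟨{ g with commutes' := fun r ↦ ?_ }, AlgHom.ext hg'⟩
  have := hg' (algebraMap R B r)
  rw [ℓ.commutes, AlgHom.commutes] at this
  exact this

/-- Lang's theorem for the points of a form of a group over a subring, with values in the algebraic
closure of a finite field. -/
theorem exists_comp_eq_of_form {R k A B ι κ : Type u} {Ω : Type*} [CommRing R] [Field k]
    [Algebra R k] [FaithfulSMul R k] [CommRing A] [IsDomain A] [HopfAlgebra k A] [Algebra R A]
    [IsScalarTower R k A] [CommRing B] [Algebra R B] {j : B →ₐ[R] A} (hj : IsForm R k j)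
    {Δ : B →ₐ[R] B ⊗[R] B} (hΔ : ∀ b, tensorComparison (k := k) j j (Δ b) = comul (R := k) (j b))
    {ε : B →ₐ[R] R} (hε : ∀ b, algebraMap R k (ε b) = counit (R := k) (j b))
    {S : B →ₗ[R] B} (hS : ∀ b, j (S b) = HopfAlgebra.antipode k (j b))
    {ψ : A →ₐ[k] A} (hψ : comul ∘ₗ ψ.toLinearMap =
      TensorProduct.map ψ.toLinearMap ψ.toLinearMap ∘ₗ comul (R := k) (A := A))
    (hinj : Function.Injective (Points.langHom ψ))
    {χ : B →ₐ[R] B} (hχ : ∀ b, j (χ b) = ψ (j b))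
    {ℓ : B →ₐ[R] B} (hℓ : ∀ b, j (ℓ b) = Points.langHom ψ (j b))
    [Fintype ι] {v : ι → B} (hv : Algebra.adjoin R (Set.range v) = ⊤) {C : ι → ι → B}
    (hC : ∀ i, comul (R := k) (j (v i)) = ∑ l, j (C i l) ⊗ₜ[k] j (v l))
    {p : ι → Polynomial B} (hp0 : ∀ i, p i ≠ 0) (hp : ∀ i, (p i).eval₂ ℓ.toRingHom (v i) = 0)
    {w : κ → B} (hw : LinearIndependent k fun e ↦
      Ideal.Quotient.mk (Ideal.span {j (∏ i, (p i).leadingCoeff)}) (j (w e)))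
    (hspan : ∀ h : B, ∃ h', ∃ r ∈ Submodule.span R (Set.range w),
      h = (∏ i, (p i).leadingCoeff) * h' + r)
    [Field Ω] [Algebra R Ω] [IsAlgClosed Ω] {Fr : Ω →ₐ[R] Ω} {q : ℕ} (hq : 2 ≤ q)
    (hFr : ∀ z, Fr z = z ^ q) (hΩ : ∀ z : Ω, ∃ m, 0 < m ∧ z ^ q ^ m = z)
    (hfix : {x : B →ₐ[R] Ω | x.comp χ = x}.Finite) (x : B →ₐ[R] Ω) :
    ∃ g : B →ₐ[R] Ω, g.comp ℓ = x := by
  have hjinj : Function.Injective j := IsForm.injective (j := j.toLinearMap) hj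
  have hj2 : IsForm R k (tensorComparison (k := k) j j) := hj.tmul hj (by simp)
  have hj₂ : Function.Injective (tensorComparison (k := k) j j) :=
    IsForm.injective (j := (tensorComparison (k := k) j j).toLinearMap) hj2
  have hj3 : IsForm R k (tensorComparison (k := k) j (tensorComparison (k := k) j j)) :=
    hj.tmul hj2 (by simp)
  have hj₃ : Function.Injective (tensorComparison (k := k) j (tensorComparison (k := k) j j)) :=
    IsForm.injective
      (j := (tensorComparison (k := k) j (tensorComparison (k := k) j j)).toLinearMap)
      hj3
  have : IsDomain B := hjinj.isDomain j.toRingHom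
  let : HopfAlgebra R B := HopfAlgebra.ofForm j hjinj hj₃ Δ hΔ ε hε S hS
  have hΔ' (b) : tensorComparison (k := k) j j (comul (R := R) b) = comul (R := k) (j b) := hΔ b
  have hS' (b) : j (HopfAlgebra.antipode R b) = HopfAlgebra.antipode k (j b) := hS b
  have hχψ := comul_comp_of_tensorComparison j hΔ' hχ hj₂ hψ
  have hlang : Points.langHom χ = ℓ := AlgHom.ext fun b ↦ hjinj <| by
    rw [hℓ, map_langHom j hΔ' hχ hS']
  have hℓinj : Function.Injective ℓ := fun a b hab ↦ hjinj <| hinj <| by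
    rw [← hℓ, ← hℓ, hab]
  have hpts (x y : Points R B Ω) :
      y * (Points.pull χ hχψ y)⁻¹ = x ↔ y.ofConv.comp ℓ = x.ofConv := by
    rw [← Points.comp_langHom, hlang]
    exact ⟨fun h ↦ congrArg WithConv.ofConv h, fun h ↦ congrArg WithConv.toConv h⟩
  have hf : ∏ i, (p i).leadingCoeff ≠ 0 :=
    Finset.prod_ne_zero_iff.mpr fun i _ ↦ Polynomial.leadingCoeff_ne_zero.mpr (hp0 i)
  obtain ⟨g, hg⟩ := Points.lang_surjective hv C (fun i ↦ hj₂ (by simp [hΔ', hC])) Fr hq hFr hΩ χ hχψ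
    (hfix.preimage WithConv.ofConv_injective.injOn |>.subset fun x hx ↦
      congrArg WithConv.ofConv hx) _
    (fun t ht ↦ tmul_mul_eq_zero_of_free j hjinj hf hw hspan t ht)
    (fun x hx ↦ by
      obtain ⟨g, hg⟩ := AlgHom.exists_comp_eq_of_leadingCoeff hℓinj hv p hp x.ofConv fun i hi ↦
        hx <| by
          rw [map_prod]
          exact Finset.prod_eq_zero (Finset.mem_univ i) hi
      exact ⟨WithConv.toConv g, (hpts _ _).mpr hg⟩) (WithConv.toConv x)
  exact ⟨g.ofConv, (hpts _ _).mp hg⟩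

end Descent

section SpreadingOut

open Filter TensorProduct Coalgebra

theorem AlgHom.exists_lift_adjoin {R A D V ι : Type*} [CommRing R] [CommRing A] [Algebra R A]
    [CommRing D] [Algebra R D] [CommRing V] [Algebra R V] {v : ι → A} (φ : A →ₐ[R] V)
    {j : D →ₐ[R] V} (hj : Function.Injective j) (h : ∀ i, φ (v i) ∈ j.range) :
    ∃ φ' : Algebra.adjoin R (Set.range v) →ₐ[R] D, ∀ b, j (φ' b) = φ b := by
  have h' (b : Algebra.adjoin R (Set.range v)) : φ b ∈ j.range := by
    have : Algebra.adjoin R (Set.range v) ≤ j.range.comap φ :=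
      Algebra.adjoin_le (by rintro _ ⟨i, rfl⟩; exact h i)
    exact this b.2
  refine ⟨(AlgEquiv.ofInjective j hj).symm.toAlgHom.comp
    ((φ.comp (Subalgebra.val _)).codRestrict j.range h'), fun b ↦ ?_⟩
  exact congrArg Subtype.val ((AlgEquiv.ofInjective j hj).apply_symm_apply ⟨φ b, h' b⟩)

variable {k A ι : Type u} [Field k] [CommRing A] [Algebra k A] {v : ι → A}

/-- The generators of `spreadAlgebra v s`. -/
def spreadGenerators (v : ι → A) (s : Finset k) (i : ι) : spreadAlgebra v s :=
  ⟨v i, Algebra.subset_adjoin ⟨i, rfl⟩⟩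

theorem adjoin_range_spreadGenerators (v : ι → A) (s : Finset k) :
    Algebra.adjoin (spreadRing s) (Set.range (spreadGenerators v s)) = ⊤ := by
  rw [← top_le_iff, ← Algebra.adjoin_adjoin_coe_preimage]
  refine Algebra.adjoin_mono ?_
  rintro ⟨_, _⟩ ⟨i, rfl⟩
  exact ⟨i, rfl⟩

theorem eventually_mem_range_tensorComparison (hv : Algebra.adjoin k (Set.range v) = ⊤)
    (t : A ⊗[k] A) : ∀ᶠ s : Finset k in atTop, t ∈ (tensorComparison (k := k)
      (spreadAlgebra v s).val (spreadAlgebra v s).val).range := by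
  induction t with
  | zero => exact .of_forall fun s ↦ zero_mem _
  | add x y hx hy => filter_upwards [hx, hy] with s hx hy using add_mem hx hy
  | tmul x y =>
    filter_upwards [eventually_mem_spreadAlgebra hv x, eventually_mem_spreadAlgebra hv y]
      with s hx hy
    exact ⟨⟨x, hx⟩ ⊗ₜ ⟨y, hy⟩, by simp⟩

theorem eventually_exists_restrict [Finite ι] (hv : Algebra.adjoin k (Set.range v) = ⊤)
    (φ : A →ₐ[k] A) : ∀ᶠ s : Finset k in atTop,
      ∃ φ' : spreadAlgebra v s →ₐ[spreadRing s] spreadAlgebra v s, ∀ b, (φ' b : A) = φ b := by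
  filter_upwards [eventually_all.mpr fun i ↦ eventually_mem_spreadAlgebra hv (φ (v i))] with s hs
  exact AlgHom.exists_lift_adjoin (φ.restrictScalars (spreadRing s)) (j := (spreadAlgebra v s).val)
    Subtype.val_injective (by simpa using hs)

/-- Generically over the base, the quotient by an element is free on a set of monomials. -/
theorem exists_generic_basis [Finite ι] (hv : Algebra.adjoin k (Set.range v) = ⊤) (f : A) :
    ∃ M : Set (ι →₀ ℕ), ∀ᶠ s : Finset k in atTop, ∃ w : M → spreadAlgebra v s,
      LinearIndependent k (fun e ↦ Ideal.Quotient.mk (Ideal.span {f}) (w e : A)) ∧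
      ∀ f' : spreadAlgebra v s, (f' : A) = f → ∀ h : spreadAlgebra v s, ∃ h',
        ∃ r ∈ Submodule.span (spreadRing s) (Set.range w), h = f' * h' + r := by
  obtain ⟨M, hM, hs⟩ := exists_monomials_generic hv f
  have hmem (s : Finset k) (e : M) :
      MvPolynomial.aeval v (MvPolynomial.monomial e.1 (1 : k)) ∈ spreadAlgebra v s := by
    rw [MvPolynomial.aeval_monomial, map_one, one_mul]
    exact prod_mem fun i _ ↦ pow_mem (Algebra.subset_adjoin (Set.mem_range_self i)) _
  refine ⟨M, ?_⟩
  filter_upwards [hs] with s hs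
  refine ⟨fun e ↦ ⟨_, hmem s e⟩, hM, ?_⟩
  rintro f' rfl ⟨h, hh⟩
  obtain ⟨h', hh', r, hr, rfl⟩ := hs h hh
  have hr' : r ∈ (Submodule.span (spreadRing s)
      (Set.range fun e : M ↦ (⟨_, hmem s e⟩ : spreadAlgebra v s))).map
        (spreadAlgebra v s).val.toLinearMap := by
    rw [Submodule.map_span, ← Set.range_comp]
    exact hr
  obtain ⟨r', hr', rfl⟩ := hr'
  exact ⟨⟨h', hh'⟩, r', hr', Subtype.ext rfl⟩

theorem eventually_isForm [Finite ι] (hv : Algebra.adjoin k (Set.range v) = ⊤) :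
    ∀ᶠ s : Finset k in atTop, IsForm (spreadRing s) k (spreadAlgebra v s).val := by
  obtain ⟨M, hM⟩ := exists_generic_basis hv 0
  filter_upwards [hM] with s ⟨w, hw, hspan⟩
  refine isForm_of_linearIndependent (spreadAlgebra v s).val (w := w) ?_ fun h ↦ ?_
  · exact hw.of_comp (Ideal.Quotient.mkₐ k (Ideal.span {(0 : A)})).toLinearMap
  · obtain ⟨h', r, hr, rfl⟩ := hspan 0 rfl h
    simpa using hr

theorem eventually_mem_lifts (hv : Algebra.adjoin k (Set.range v) = ⊤) (p : Polynomial A) :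
    ∀ᶠ s : Finset k in atTop, ∃ p' : Polynomial (spreadAlgebra v s),
      p'.map (spreadAlgebra v s).val.toRingHom = p := by
  have : ∀ᶠ s : Finset k in atTop, ∀ n ∈ p.support, p.coeff n ∈ spreadAlgebra v s :=
    (eventually_all_finset _).mpr fun n _ ↦ eventually_mem_spreadAlgebra hv _
  filter_upwards [this] with s hs
  refine (Polynomial.mem_lifts p).mp ((Polynomial.lifts_iff_coeff_lifts _).mpr fun n ↦ ?_)
  by_cases hn : n ∈ p.support
  · exact ⟨⟨_, hs n hn⟩, rfl⟩
  · exact ⟨0, by simpa using (Polynomial.notMem_support_iff.mp hn).symm⟩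

theorem eventually_mem_lifts_spreadRing (p : Polynomial k) :
    ∀ᶠ s : Finset k in atTop, p ∈ Polynomial.lifts (algebraMap (spreadRing s) k) := by
  have : ∀ᶠ s : Finset k in atTop, ∀ n ∈ p.support, p.coeff n ∈ spreadRing s :=
    (eventually_all_finset _).mpr fun n _ ↦ eventually_mem_spreadRing _
  filter_upwards [this] with s hs
  refine (Polynomial.lifts_iff_coeff_lifts _).mpr fun n ↦ ?_
  by_cases hn : n ∈ p.support
  · exact ⟨⟨_, hs n hn⟩, rfl⟩
  · exact ⟨0, by simpa using (Polynomial.notMem_support_iff.mp hn).symm⟩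

theorem eventually_mem_span (hv : Algebra.adjoin k (Set.range v) = ⊤) {E : Set A}
    {E' : ∀ s : Finset k, Set (spreadAlgebra v s)}
    (hE : ∀ a ∈ E, ∀ᶠ s : Finset k in atTop, ∃ b ∈ E' s, (b : A) = a) {a : A}
    (ha : a ∈ Ideal.span E) : ∀ᶠ s : Finset k in atTop, ∃ b ∈ Ideal.span (E' s), (b : A) = a := by
  induction ha using Submodule.span_induction with
  | mem a ha => exact (hE a ha).mono fun s ⟨b, hb, hba⟩ ↦ ⟨b, Ideal.subset_span hb, hba⟩
  | zero => exact .of_forall fun s ↦ ⟨0, zero_mem _, rfl⟩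
  | add a₁ a₂ _ _ h₁ h₂ =>
    filter_upwards [h₁, h₂] with s ⟨b₁, hb₁, h₁⟩ ⟨b₂, hb₂, h₂⟩
    exact ⟨b₁ + b₂, add_mem hb₁ hb₂, by simp [h₁, h₂]⟩
  | smul c a _ ha =>
    filter_upwards [ha, eventually_mem_spreadAlgebra hv c] with s ⟨b, hb, hba⟩ hc
    exact ⟨⟨c, hc⟩ * b, Ideal.mul_mem_left _ _ hb, by simp [hba]⟩

/-- Generically over the base, finiteness of the fixed point scheme persists in the fibres. -/
theorem eventually_finite_fixedPoints [Finite ι] (hv : Algebra.adjoin k (Set.range v) = ⊤)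
    (ψ : A →ₐ[k] A) (hfix : Module.Finite k (A ⧸ Ideal.span {x : A | ∃ a : A, x = ψ a - a})) :
    ∀ᶠ s : Finset k in atTop,
      ∀ χ : spreadAlgebra v s →ₐ[spreadRing s] spreadAlgebra v s, (∀ b, (χ b : A) = ψ b) →
      ∀ (Ω : Type u) [Field Ω] [Algebra (spreadRing s) Ω],
        {x : spreadAlgebra v s →ₐ[spreadRing s] Ω | x.comp χ = x}.Finite := by
  have hint (i) : ∃ p : Polynomial k, p.Monic ∧
      Polynomial.aeval (v i) p ∈ Ideal.span {x : A | ∃ a : A, x = ψ a - a} := by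
    obtain ⟨p, hp, hp0⟩ := Algebra.IsIntegral.isIntegral (R := k)
      (Ideal.Quotient.mk (Ideal.span {x : A | ∃ a : A, x = ψ a - a}) (v i))
    refine ⟨p, hp, ?_⟩
    rw [← Ideal.Quotient.eq_zero_iff_mem, ← Ideal.Quotient.mkₐ_eq_mk k,
      ← Polynomial.aeval_algHom_apply]
    exact hp0
  choose p hp hpI using hint
  have hE : ∀ y ∈ {x : A | ∃ a : A, x = ψ a - a}, ∀ᶠ s : Finset k in atTop,
      ∃ b ∈ {b : spreadAlgebra v s | ∃ a : spreadAlgebra v s, (b : A) = ψ a - a}, (b : A) = y := by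
    rintro _ ⟨a, rfl⟩
    filter_upwards [eventually_mem_spreadAlgebra hv a, eventually_mem_spreadAlgebra hv (ψ a)]
      with s ha hψa
    exact ⟨⟨ψ a, hψa⟩ - ⟨a, ha⟩, ⟨⟨a, ha⟩, rfl⟩, rfl⟩
  filter_upwards [eventually_all.mpr fun i ↦ eventually_mem_span hv hE (hpI i),
    eventually_all.mpr fun i ↦ eventually_mem_lifts_spreadRing (p i)] with s hs hlift χ hχ Ω _ _
  have hlift' (i) := Polynomial.lifts_and_degree_eq_and_monic (hlift i) (hp i)
  choose P hP _ hPm using hlift'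
  let v' := spreadGenerators v s
  refine Set.Finite.of_finite_image (f := fun x i ↦ x (v' i))
    ((Set.Finite.pi' fun i ↦ Polynomial.finite_setOfPred_isRoot
      ((hPm i).map (algebraMap (spreadRing s) Ω)).ne_zero).subset ?_) fun x _ y _ h ↦
        AlgHom.ext_of_adjoin_eq_top (adjoin_range_spreadGenerators v s)
          (by rintro _ ⟨i, rfl⟩; exact congrFun h i)
  rintro _ ⟨x, hx, rfl⟩ i
  obtain ⟨b, hb, hbp⟩ := hs i
  have hbP : b = Polynomial.aeval (v' i) (P i) := by
    refine Subtype.ext (hbp.trans ?_)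
    rw [← hP i, Polynomial.aeval_map_algebraMap]
    exact Polynomial.aeval_algHom_apply (spreadAlgebra v s).val (v' i) (P i)
  have hker : Ideal.span {b : spreadAlgebra v s | ∃ a : spreadAlgebra v s, (b : A) = ψ a - a} ≤
      RingHom.ker x := by
    refine Ideal.span_le.mpr ?_
    rintro b ⟨a, hab⟩
    have hb : b = χ a - a := Subtype.ext (hab.trans (by simp [hχ]))
    rw [SetLike.mem_coe, RingHom.mem_ker, hb, map_sub, ← AlgHom.comp_apply, hx, sub_self]
  have h : x (Polynomial.aeval (v' i) (P i)) = 0 := hbP ▸ hker hb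
  rw [← Polynomial.aeval_algHom_apply] at h
  simpa [Polynomial.IsRoot, Polynomial.eval_map_algebraMap] using h

end SpreadingOut

section SpreadingOut

open Filter TensorProduct Coalgebra

/-- Generically over the base, Lang's theorem holds for the points of a model with values in the
algebraic closure of a finite field. -/
theorem eventually_exists_comp_langHom_eq {k A : Type u} [Field k] [CommRing A] [IsDomain A]
    [HopfAlgebra k A] [Algebra.FiniteType k A] {T : Finset A}
    (hT : Algebra.adjoin k (T : Set A) = ⊤)
    (hTC : ∀ t ∈ T, ∃ C : A → A, comul (R := k) t = ∑ w ∈ T, C w ⊗ₜ[k] w)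
    {ψ : A →ₐ[k] A} (hψ : comul ∘ₗ ψ.toLinearMap =
      TensorProduct.map ψ.toLinearMap ψ.toLinearMap ∘ₗ comul (R := k) (A := A))
    (hfix : Module.Finite k (A ⧸ Ideal.span {x : A | ∃ a : A, x = ψ a - a}))
    (hinj : Function.Injective (Points.langHom ψ)) :
    ∀ᶠ s : Finset k in atTop,
      ∃ ℓ : spreadAlgebra ((↑) : T → A) s →ₐ[spreadRing s] spreadAlgebra ((↑) : T → A) s,
        (∀ b, (ℓ b : A) = Points.langHom ψ b) ∧
        ∀ (Ω : Type u) [Field Ω] [Algebra (spreadRing s) Ω] [IsAlgClosed Ω]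
          (Fr : Ω →ₐ[spreadRing s] Ω) (q : ℕ), 2 ≤ q → (∀ z, Fr z = z ^ q) →
          (∀ z : Ω, ∃ m, 0 < m ∧ z ^ q ^ m = z) →
          ∀ x : spreadAlgebra ((↑) : T → A) s →ₐ[spreadRing s] Ω,
            ∃ g : spreadAlgebra ((↑) : T → A) s →ₐ[spreadRing s] Ω, g.comp ℓ = x := by
  let v : T → A := (↑)
  have hv : Algebra.adjoin k (Set.range v) = ⊤ := by rwa [Subtype.range_coe]
  have hC (i : T) : ∃ C : T → A, comul (R := k) (v i) = ∑ l, C l ⊗ₜ[k] v l := by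
    obtain ⟨C, hC⟩ := hTC i i.2
    exact ⟨fun l ↦ C l, by rw [hC, ← Finset.sum_coe_sort]⟩
  choose C hC using hC
  choose p hp0 hp using fun i ↦ AlgHom.exists_polynomial_eval₂_eq_zero _ hinj (v i)
  obtain ⟨M, hM⟩ := exists_generic_basis hv (∏ i, (p i).leadingCoeff)
  filter_upwards [hM, eventually_isForm hv, eventually_exists_restrict hv ψ,
    eventually_exists_restrict hv (Points.langHom ψ),
    eventually_exists_restrict hv (HopfAlgebra.antipodeAlgHom k A),
    eventually_all.mpr fun i ↦ eventually_mem_range_tensorComparison hv (comul (R := k) (v i)),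
    eventually_all.mpr fun i ↦ eventually_mem_spreadRing (counit (R := k) (v i)),
    eventually_all.mpr fun i ↦ eventually_all.mpr fun l ↦ eventually_mem_spreadAlgebra hv (C i l),
    eventually_all.mpr fun i ↦ eventually_mem_lifts hv (p i),
    eventually_finite_fixedPoints hv ψ hfix]
    with s ⟨w, hw, hspan⟩ hj ⟨χ, hχ⟩ ⟨ℓ, hℓ⟩ ⟨S, hS⟩ hΔ hε hCs hps hfin
  choose P hP using hps
  let j := (spreadAlgebra v s).val
  have hj2 : IsForm (spreadRing s) k (tensorComparison (k := k) j j) := 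
    hj.tmul hj (tensorComparison_tmul j j)
  obtain ⟨Δ, hΔ⟩ := AlgHom.exists_lift_adjoin
    ((Bialgebra.comulAlgHom k A).restrictScalars (spreadRing s))
    (j := tensorComparison (k := k) j j)
    (IsForm.injective (j := (tensorComparison (k := k) j j).toLinearMap) hj2) hΔ
  obtain ⟨ε, hε⟩ := AlgHom.exists_lift_adjoin
    ((Bialgebra.counitAlgHom k A).restrictScalars (spreadRing s))
    (j := Algebra.ofId (spreadRing s) k) Subtype.val_injective
    (fun i ↦ ⟨⟨_, hε i⟩, rfl⟩)
  have hPinj : Function.Injective j.toRingHom := Subtype.val_injective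
  have hlead : ((∏ i, (P i).leadingCoeff : spreadAlgebra v s) : A) = ∏ i, (p i).leadingCoeff := by
    change j.toRingHom _ = _
    rw [map_prod]
    refine Finset.prod_congr rfl fun i _ ↦ ?_
    rw [← hP i, Polynomial.leadingCoeff_map_of_injective hPinj]
  refine ⟨ℓ, hℓ, fun Ω _ _ _ Fr q hq hFr hΩ x ↦ ?_⟩
  refine exists_comp_eq_of_form (k := k) (j := j) (κ := M) (w := w) (S := S.toLinearMap)
    (v := spreadGenerators v s) (C := fun i l ↦ ⟨C i l, hCs i l⟩) (p := P) hj hΔ hε hS hψ hinj hχ hℓ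
    (adjoin_range_spreadGenerators v s) hC (fun i hi ↦ hp0 i ?_) (fun i ↦ ?_) ?_
    (hspan _ hlead) hq hFr hΩ (hfin χ hχ Ω) x
  · rw [← hP i, hi, Polynomial.map_zero]
  · refine hPinj ?_
    rw [Polynomial.hom_eval₂, map_zero, ← hp i, ← hP i, Polynomial.eval₂_map]
    congr 1
    exact RingHom.ext hℓ
  · change LinearIndependent k fun e ↦
      Ideal.Quotient.mk (Ideal.span {((_ : spreadAlgebra v s) : A)}) (w e : A)
    rwa [hlead]

end SpreadingOut

section SpreadingOut

open Filter TensorProduct Coalgebra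

/-- A finite type algebra over a finite type `ℤ`-algebra has points in the algebraic closure of a
finite field, outside any proper ideal. -/
theorem exists_algHom_algebraicClosure {R B : Type u} [CommRing R] [CommRing B] [Algebra R B]
    [Algebra.FiniteType ℤ R] [Algebra.FiniteType R B] {I : Ideal B} (hI : I ≠ ⊤) :
    ∃ (Ω : Type u) (_ : Field Ω) (_ : Algebra R Ω) (_ : IsAlgClosed Ω) (Fr : Ω →ₐ[R] Ω) (q : ℕ)
      (x : B →ₐ[R] Ω), 2 ≤ q ∧ (∀ z, Fr z = z ^ q) ∧ (∀ z : Ω, ∃ m, 0 < m ∧ z ^ q ^ m = z) ∧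
        ∀ b ∈ I, x b = 0 := by
  obtain ⟨M, hM, hIM⟩ := Ideal.exists_le_maximal I hI
  let : Field (B ⧸ M) := Ideal.Quotient.field M
  have : Algebra.FiniteType R (B ⧸ M) := inferInstance
  have : Algebra.FiniteType ℤ (B ⧸ M) := .trans (S := R) ‹_› ‹_›
  have : Finite (B ⧸ M) := @Field.finite_of_finiteType_int (B ⧸ M) _ this
  let : Fintype (B ⧸ M) := .ofFinite _
  let Ω := AlgebraicClosure (B ⧸ M)
  refine ⟨Ω, inferInstance, inferInstance, inferInstance,
    (FiniteField.frobeniusAlgHom (B ⧸ M) Ω).restrictScalars R, Fintype.card (B ⧸ M),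
    (IsScalarTower.toAlgHom R (B ⧸ M) Ω).comp (Ideal.Quotient.mkₐ R M), Fintype.one_lt_card,
    fun z ↦ rfl, fun z ↦ ?_, fun b hb ↦ ?_⟩
  · let K := IntermediateField.adjoin (B ⧸ M) {z}
    have : FiniteDimensional (B ⧸ M) K :=
      IntermediateField.adjoin.finiteDimensional (Algebra.IsIntegral.isIntegral z)
    have : Finite K := Module.finite_of_finite (B ⧸ M)
    let : Fintype K := .ofFinite K
    refine ⟨Module.finrank (B ⧸ M) K, Module.finrank_pos, ?_⟩
    rw [← Module.card_eq_pow_finrank (K := B ⧸ M) (V := K)]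
    exact congrArg Subtype.val
      (FiniteField.pow_card (⟨z, IntermediateField.mem_adjoin_simple_self _ z⟩ : K))
  · have : Ideal.Quotient.mk M b = 0 := Ideal.Quotient.eq_zero_iff_mem.mpr (hIM hb)
    simp [this]

theorem Points.map_langHom_ne_top {k A : Type u} [Field k] [CommRing A] [IsDomain A]
    [HopfAlgebra k A] [Algebra.FiniteType k A]
    {ψ : A →ₐ[k] A} (hψ : comul ∘ₗ ψ.toLinearMap =
      TensorProduct.map ψ.toLinearMap ψ.toLinearMap ∘ₗ comul (R := k) (A := A))
    (hfix : Module.Finite k (A ⧸ Ideal.span {x : A | ∃ a : A, x = ψ a - a}))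
    {I : Ideal A} (hI : I ≠ ⊤) : I.map (langHom ψ).toRingHom ≠ ⊤ := by
  intro htop
  obtain ⟨T, hT, hTC⟩ := Coalgebra.exists_finset_adjoin_eq_top (k := k) (A := A)
  let v : T → A := (↑)
  have hv : Algebra.adjoin k (Set.range v) = ⊤ := by rwa [Subtype.range_coe]
  have hE : ∀ y ∈ (langHom ψ).toRingHom '' I, ∀ᶠ s : Finset k in atTop,
      ∃ b ∈ {b : spreadAlgebra v s | ∃ a : spreadAlgebra v s, (a : A) ∈ I ∧
        (b : A) = langHom ψ a}, (b : A) = y := by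
    rintro _ ⟨a, ha, rfl⟩
    filter_upwards [eventually_mem_spreadAlgebra hv a,
      eventually_mem_spreadAlgebra hv (langHom ψ a)] with s has hLa
    exact ⟨⟨_, hLa⟩, ⟨⟨a, has⟩, ha, rfl⟩, rfl⟩
  obtain ⟨s, ⟨b, hb, hb1⟩, ℓ, hℓ, hlang⟩ :=
    ((eventually_mem_span hv hE (a := 1) ((Ideal.eq_top_iff_one _).mp htop)).and
      (eventually_exists_comp_langHom_eq hT hTC hψ hfix (langHom_injective ψ hψ hfix))).exists
  have : Algebra.FiniteType ℤ (spreadRing s) :=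
    Subalgebra.fg_iff_finiteType _ |>.mp (Subalgebra.fg_adjoin_finset s)
  have : Algebra.FiniteType (spreadRing s) (spreadAlgebra v s) :=
    Subalgebra.fg_iff_finiteType _ |>.mp (Subalgebra.fg_def.mpr
      ⟨_, Set.finite_range v, rfl⟩)
  have hIs : I.comap (spreadAlgebra v s).val.toRingHom ≠ ⊤ := Ideal.comap_ne_top _ hI
  obtain ⟨Ω, _, _, _, Fr, q, x, hq, hFr, hΩ, hx⟩ :=
    exists_algHom_algebraicClosure (R := spreadRing s) hIs
  obtain ⟨g, rfl⟩ := hlang Ω Fr q hq hFr hΩ x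
  have hker : Ideal.span {b : spreadAlgebra v s | ∃ a : spreadAlgebra v s, (a : A) ∈ I ∧
      (b : A) = langHom ψ a} ≤ RingHom.ker g := by
    refine Ideal.span_le.mpr ?_
    rintro b ⟨a, ha, hab⟩
    have hb : b = ℓ a := Subtype.ext (hab.trans (hℓ a).symm)
    rw [SetLike.mem_coe, RingHom.mem_ker, hb]
    exact hx a ha
  have h1 : b = 1 := Subtype.ext hb1
  exact one_ne_zero ((map_one g).symm.trans (h1 ▸ hker hb))

end SpreadingOut

open TensorProduct in
/-- Let `G` be a connected algebraic group over a field `k` and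
`φ : G → G` an isogeny with only finitely many fixed points.  Then the Lang map
`L : G → G`, `L(g) = g·φ(g)⁻¹`, is faithfully flat.

Formalization via coordinate rings (Mathlib has no group schemes): `G = Spec A` for a
commutative Hopf algebra `A` over `k` which is of finite type and smooth, with `Spec A`
connected.  The isogeny `φ` corresponds to a map `ψ : A → A` of Hopf algebras
(an algebra map compatible with comultiplication) which is injective (surjectivity of
`φ`) and whose kernel, the fibre of `φ` over the neutral element
`Spec (A/(ψ(ker ε)))`, is finite; the fixed-point scheme of `φ` is
`Spec (A/(ψ(a) − a : a ∈ A))`, assumed finite over `k`.  The comorphism of the Lang map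
is `x ↦ m((id ⊗ (ψ ∘ antipode))(Δ x))`; for any ring homomorphism `L : A → A` whose
underlying map is this comorphism, `A` is a faithfully flat module over itself via `L`,
i.e. the Lang morphism `Spec L` is faithfully flat. -/
theorem stmt_6 {k : Type u} [Field k] {A : Type u} [CommRing A] [HopfAlgebra k A]
    [Algebra.FiniteType k A] [Algebra.Smooth k A]
    -- `G = Spec A` is connected:
    (hconn : ConnectedSpace (PrimeSpectrum A))
    -- the comorphism `ψ` of the isogeny `φ`, a morphism of Hopf algebras:
    (ψ : A →ₐ[k] A)
    (hbialg : Coalgebra.comul ∘ₗ ψ.toLinearMap =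
      TensorProduct.map ψ.toLinearMap ψ.toLinearMap ∘ₗ (Coalgebra.comul (R := k) (A := A)))
    -- `φ` is surjective:
    (hψinj : Function.Injective ψ)
    -- the kernel of the isogeny `φ` is finite:
    (hker : Module.Finite k
      (A ⧸ (Ideal.span (⇑ψ '' (RingHom.ker (Bialgebra.counitAlgHom k A))) : Ideal A)))
    -- `φ` has only finitely many fixed points:
    (hfix : Module.Finite k (A ⧸ (Ideal.span {x : A | ∃ a : A, x = ψ a - a} : Ideal A)))
    -- `L` is the comorphism of the Lang map `g ↦ g·φ(g)⁻¹`: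
    (L : A →+* A)
    (hL : ∀ x : A, L x = LinearMap.mul' k A
      ((TensorProduct.map LinearMap.id
        (ψ.toLinearMap ∘ₗ (HopfAlgebra.antipode (R := k) (A := A))))
        (Coalgebra.comul x))) :
    letI : Module A A := Module.compHom A L
    Module.FaithfullyFlat A A := by
  have := isDomain_of_smooth_of_connectedSpace (k := k) hconn
  obtain rfl : L = (Points.langHom ψ).toRingHom :=
    RingHom.ext fun x ↦ (hL x).trans (Points.langHom_apply ψ x).symm
  have hinj := Points.langHom_injective ψ hbialg hfix
  exact RingHom.FaithfullyFlat.of_flat_of_forall_isMaximal (Points.langHom_flat ψ hbialg hinj)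
    fun m hm ↦ Points.map_langHom_ne_top hbialg hfix hm.ne_top
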